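/- For every integer k ≥ 1 there is a constant D = D(k), depending only on k, such that every shortest-path metric supported on a graph of pathwidth at most k admits a stochastic D-embedding into the family of shortest-path metrics supported on trees of pathwidth at most k. In symbols, Pathwidth(k) ⇝ Trees ∩ Pathwidth(k). -/

import Mathlib

open scoped BigOperators

/-- A path decomposition of `G` with `t` bags. -/
def IsPathDecomp {V : Type*} (G : SimpleGraph V) (t : ℕ) (X : Fin t → Finset V) : Prop :=
  (∀ v : V, ∃ i, v ∈ X i) ∧
  (∀ ⦃u v : V⦄, G.Adj u v → ∃ i, u ∈ X i ∧ v ∈ X i) ∧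
  (∀ (v : V) (i j l : Fin t), i ≤ j → j ≤ l → v ∈ X i → v ∈ X l → v ∈ X j)

/-- The pathwidth of `G` is at most `k`. -/
def pathwidthLE {V : Type*} (G : SimpleGraph V) (k : ℕ) : Prop :=
  ∃ (t : ℕ) (X : Fin t → Finset V), IsPathDecomp G t X ∧ ∀ i, (X i).card ≤ k + 1

/-- The pathwidth of `G`. -/
noncomputable def pathwidth {V : Type*} (G : SimpleGraph V) : ℕ :=
  sInf {k | pathwidthLE G k}
/-- Shortest-path (pseudo)metric of the metric graph `(G, len)`. -/
noncomputable def spDist {V : Type*} (G : SimpleGraph V) (len : Sym2 V → ℝ) (u v : V) : ℝ :=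
  sInf (Set.range fun w : G.Walk u v => (w.edges.map len).sum)
/-- A finite "metric space": a size `n` together with a distance function on `Fin n`. -/
def FinMetric : Type := (n : ℕ) × (Fin n → Fin n → ℝ)

/-- A family of finite graphs (one set of graphs for each vertex count). -/
def GraphFamily : Type := ∀ n : ℕ, Set (SimpleGraph (Fin n))

/-- The shortest-path metrics supported on (connected) metric graphs from the family `F`. -/
def SupportedMetrics (F : GraphFamily) : Set FinMetric :=
  { Y | ∃ G ∈ F Y.1, G.Connected ∧ ∃ len : Sym2 (Fin Y.1) → ℝ,
      (∀ e, 0 ≤ len e) ∧ ∀ u v, Y.2 u v = spDist G len u v }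
/-- `(X, d)` admits a stochastic `D`-embedding into the family `𝒴`: there is a finitely
supported random metric space `Y ∈ 𝒴` and a random map `F` into it which is almost surely
non-contracting, and whose expected expansion is at most `D` on every pair. -/
def StochEmbeds {X : Type*} [Fintype X] (d : X → X → ℝ) (𝒴 : Set FinMetric) (D : ℝ) : Prop :=
  ∃ (N : ℕ) (p : Fin N → ℝ) (Y : Fin N → FinMetric) (F : (ω : Fin N) → X → Fin (Y ω).1),
    (∀ ω, 0 ≤ p ω) ∧ (∑ ω, p ω = 1) ∧
    (∀ ω, p ω ≠ 0 → Y ω ∈ 𝒴) ∧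
    (∀ ω, p ω ≠ 0 → ∀ x y, d x y ≤ (Y ω).2 (F ω x) (F ω y)) ∧
    (∀ x y, (∑ ω, p ω * (Y ω).2 (F ω x) (F ω y)) ≤ D * d x y)
/-- All graphs of pathwidth at most `k`. -/
def PathwidthFam (k : ℕ) : GraphFamily := fun _ => {G | pathwidthLE G k}

/-- All trees (connected acyclic graphs). -/
def TreeFam : GraphFamily := fun _ => {G | G.IsTree}

/-- All trees of pathwidth at most `k`. -/
def TreePathwidthFam (k : ℕ) : GraphFamily := fun _ => {G | G.IsTree ∧ pathwidthLE G k}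

/-- A real-valued pseudometric. -/
structure IsPseudometric {V : Type} (c : V → V → ℝ) : Prop where
  self : ∀ x, c x x = 0
  symm : ∀ x y, c x y = c y x
  triangle : ∀ x y z, c x z ≤ c x y + c y z

namespace IsPseudometric

variable {V : Type} {c : V → V → ℝ}

lemma nonneg (hc : IsPseudometric c) (x y : V) : 0 ≤ c x y := by
  have h1 := hc.triangle x y x
  rw [hc.self, hc.symm y x] at h1
  linarith

lemma zero : IsPseudometric (fun _ _ : V => (0 : ℝ)) :=
  ⟨fun _ => rfl, fun _ _ => rfl, fun _ _ _ => by simp⟩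

lemma max_abs_sub (hc : IsPseudometric c) (f : V → ℝ) :
    IsPseudometric (fun x y => max (c x y) |f x - f y|) where
  self x := by simp [hc.self]
  symm x y := by simp only [hc.symm x y, abs_sub_comm]
  triangle x y z := by
    refine max_le ?_ ?_
    · exact (hc.triangle x y z).trans (add_le_add (le_max_left _ _) (le_max_left _ _))
    · exact (abs_sub_le _ _ _).trans (add_le_add (le_max_right _ _) (le_max_right _ _))

end IsPseudometric

/-- The length function on edges induced by a symmetric function of two vertices. -/
def edgeLength {V : Type} (c : V → V → ℝ) (hc : ∀ x y, c x y = c y x) : Sym2 V → ℝ :=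
  Sym2.lift ⟨c, hc⟩

section ShortestPath

variable {V : Type} {G : SimpleGraph V} {len : Sym2 V → ℝ}

lemma walk_length_nonneg (hl : ∀ e, 0 ≤ len e) {u v : V} (w : G.Walk u v) :
    0 ≤ (w.edges.map len).sum :=
  List.sum_nonneg fun x hx => by
    obtain ⟨e, -, rfl⟩ := List.mem_map.1 hx
    exact hl e

lemma spDist_le_walk (hl : ∀ e, 0 ≤ len e) {u v : V} (w : G.Walk u v) :
    spDist G len u v ≤ (w.edges.map len).sum :=
  csInf_le ⟨0, by rintro _ ⟨w, rfl⟩; exact walk_length_nonneg hl w⟩ ⟨w, rfl⟩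

lemma le_spDist {u v : V} (h : G.Reachable u v) {a : ℝ}
    (ha : ∀ w : G.Walk u v, a ≤ (w.edges.map len).sum) : a ≤ spDist G len u v := by
  obtain ⟨w⟩ := h
  exact le_csInf ⟨_, ⟨w, rfl⟩⟩ (by rintro _ ⟨w, rfl⟩; exact ha w)

lemma spDist_nonneg (hl : ∀ e, 0 ≤ len e) (u v : V) : 0 ≤ spDist G len u v :=
  Real.sInf_nonneg (by rintro _ ⟨w, rfl⟩; exact walk_length_nonneg hl w)

lemma spDist_le_of_adj (hl : ∀ e, 0 ≤ len e) {u v : V} (h : G.Adj u v) :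
    spDist G len u v ≤ len s(u, v) := by
  simpa using spDist_le_walk hl h.toWalk

lemma spDist_self (hl : ∀ e, 0 ≤ len e) (u : V) : spDist G len u u = 0 :=
  le_antisymm (by simpa using spDist_le_walk hl (SimpleGraph.Walk.nil : G.Walk u u))
    (spDist_nonneg hl u u)

/-- The infimum defining the shortest-path distance is attained by a path. -/
lemma exists_path_length_eq_spDist [Finite V] (hl : ∀ e, 0 ≤ len e) {u v : V}
    (h : G.Reachable u v) :
    ∃ w : G.Walk u v, w.IsPath ∧ (w.edges.map len).sum = spDist G len u v := by
  classical
  have := Fintype.ofFinite V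
  have : Fintype (G.Path u v) := Fintype.ofFinite _
  obtain ⟨w₀⟩ := h
  have : Nonempty (G.Path u v) := ⟨w₀.toPath⟩
  obtain ⟨p, hp⟩ := Finite.exists_min (fun p : G.Path u v => (p.1.edges.map len).sum)
  refine ⟨p.1, p.2, le_antisymm (le_spDist ⟨w₀⟩ fun w => (hp w.toPath).trans ?_)
    (spDist_le_walk hl _)⟩
  have hs : (w.bypass.edges.map len).Sublist (w.edges.map len) :=
    w.edges_bypass_sublist_edges.map _
  refine hs.sum_le_sum fun x hx => ?_
  obtain ⟨e, -, rfl⟩ := List.mem_map.1 hx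
  exact hl e

lemma spDist_le_add_of_adj [Finite V] (hl : ∀ e, 0 ≤ len e) {u v z : V} (h : G.Adj u v)
    (hr : G.Reachable v z) : spDist G len u z ≤ len s(u, v) + spDist G len v z := by
  obtain ⟨w, -, hw⟩ := exists_path_length_eq_spDist hl hr
  simpa [hw] using spDist_le_walk hl (SimpleGraph.Walk.cons h w)

lemma isPseudometric_spDist [Finite V] (hl : ∀ e, 0 ≤ len e) (hG : G.Connected) :
    IsPseudometric (spDist G len) where
  self := spDist_self hl
  symm := by
    have key : ∀ x y, spDist G len x y ≤ spDist G len y x := by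
      intro x y
      obtain ⟨w, -, hw⟩ := exists_path_length_eq_spDist hl (hG.preconnected y x)
      simpa [hw] using spDist_le_walk hl w.reverse
    exact fun x y => le_antisymm (key x y) (key y x)
  triangle x y z := by
    obtain ⟨w, -, hw⟩ := exists_path_length_eq_spDist hl (hG.preconnected x y)
    obtain ⟨w', -, hw'⟩ := exists_path_length_eq_spDist hl (hG.preconnected y z)
    simpa [hw, hw'] using spDist_le_walk hl (w.append w')

/-- A pseudometric is bounded along a walk by any edge lengths dominating it. -/
lemma IsPseudometric.le_walk_length {c : V → V → ℝ} (hc : IsPseudometric c)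
    (h : ∀ u v, G.Adj u v → c u v ≤ len s(u, v)) {u v : V} (w : G.Walk u v) :
    c u v ≤ (w.edges.map len).sum := by
  induction w with
  | nil => simp [hc.self]
  | cons ha p ih =>
    simp only [SimpleGraph.Walk.edges_cons, List.map_cons, List.sum_cons]
    exact (hc.triangle _ _ _).trans (add_le_add (h _ _ ha) ih)

end ShortestPath

section RandomCut

/-- The first index of the segment containing an index, when the line `ℕ` is cut between `l` and
`l + 1` for every `l` satisfying `cut`. -/
noncomputable def segRoot (cut : ℕ → Prop) : ℕ → ℕ
  | 0 => 0
  | i + 1 => open Classical in if cut i then i + 1 else segRoot cut i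

/-- The cost of connecting the point of index `i` to the apex through the first point of its
segment. -/
noncomputable def segCost (cut : ℕ → Prop) (p h : ℕ → ℝ) (i : ℕ) : ℝ :=
  p i - p (segRoot cut i) + h (segRoot cut i)

open Classical in
/-- The distance between two points of a cut line in the tree obtained by joining the first point
of each segment to an apex. -/
noncomputable def segDist (cut : ℕ → Prop) (p h : ℕ → ℝ) (i j : ℕ) : ℝ :=
  if segRoot cut i = segRoot cut j then |p i - p j| else segCost cut p h i + segCost cut p h j

variable {cut : ℕ → Prop}

lemma segRoot_succ_of_cut {i : ℕ} (h : cut i) : segRoot cut (i + 1) = i + 1 := by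
  simp [segRoot, h]

lemma segRoot_succ_of_not_cut {i : ℕ} (h : ¬ cut i) : segRoot cut (i + 1) = segRoot cut i := by
  simp [segRoot, h]

lemma segRoot_le (i : ℕ) : segRoot cut i ≤ i := by
  induction i with
  | zero => simp [segRoot]
  | succ i ih =>
    by_cases h : cut i
    · rw [segRoot_succ_of_cut h]
    · rw [segRoot_succ_of_not_cut h]; lia

lemma segRoot_segRoot (i : ℕ) : segRoot cut (segRoot cut i) = segRoot cut i := by
  induction i with
  | zero => simp [segRoot]
  | succ i ih =>
    by_cases h : cut i
    · rw [segRoot_succ_of_cut h, segRoot_succ_of_cut h]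
    · rw [segRoot_succ_of_not_cut h, ih]

lemma lt_segRoot_of_cut {l j : ℕ} (h : cut l) (hlj : l < j) : l < segRoot cut j := by
  induction j with
  | zero => lia
  | succ j ih =>
    by_cases hj : cut j
    · rw [segRoot_succ_of_cut hj]; lia
    · rw [segRoot_succ_of_not_cut hj]
      exact ih (lt_of_le_of_ne (Nat.lt_succ_iff.1 hlj) (by rintro rfl; exact hj h))

lemma not_cut_of_segRoot_eq {i j l : ℕ} (h : segRoot cut i = segRoot cut j) (hil : i ≤ l)
    (hlj : l < j) : ¬ cut l := fun hl => by
  have h1 := lt_segRoot_of_cut hl hlj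
  have h2 : segRoot cut i ≤ i := segRoot_le i
  lia

lemma segRoot_eq_of_not_cut {i j : ℕ} (hij : i ≤ j) (h : ∀ l, i ≤ l → l < j → ¬ cut l) :
    segRoot cut i = segRoot cut j := by
  induction j, hij using Nat.le_induction with
  | base => rfl
  | succ j hj ih =>
    rw [segRoot_succ_of_not_cut (h j hj (Nat.lt_succ_self j))]
    exact ih fun l h1 h2 => h l h1 (by lia)

lemma exists_pos_le_of_pos (S : Finset ℝ) : ∃ ε > 0, ∀ x ∈ S, 0 < x → ε ≤ x := by
  induction S using Finset.induction_on with
  | empty => exact ⟨1, one_pos, by simp⟩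
  | insert a S _ ih =>
    obtain ⟨ε, hε, h⟩ := ih
    by_cases ha : 0 < a
    · refine ⟨min ε a, lt_min hε ha, fun x hx hx0 => ?_⟩
      rcases Finset.mem_insert.1 hx with rfl | hx
      · exact min_le_right _ _
      · exact (min_le_left _ _).trans (h x hx hx0)
    · refine ⟨ε, hε, fun x hx hx0 => ?_⟩
      rcases Finset.mem_insert.1 hx with rfl | hx
      · exact absurd hx0 ha
      · exact h x hx hx0

lemma exists_pos_le_sub (f : ℕ → ℝ) (n : ℕ) :
    ∃ ε > 0, ∀ i ≤ n, ∀ j ≤ n, 0 < f j - f i → ε ≤ f j - f i := by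
  obtain ⟨ε, hε, h⟩ := exists_pos_le_of_pos
    ((Finset.range (n + 1) ×ˢ Finset.range (n + 1)).image fun x => f x.2 - f x.1)
  refine ⟨ε, hε, fun i hi j hj => h _ (Finset.mem_image.2 ⟨(i, j), ?_, rfl⟩)⟩
  simp; lia

lemma sum_range_add_div {N : ℕ} (hN : 0 < N) (z : ℕ) :
    ∑ ω ∈ Finset.range N, (z + ω) / N = z := by
  induction z with
  | zero =>
    refine Finset.sum_eq_zero fun ω hω => ?_
    rw [zero_add]
    exact Nat.div_eq_of_lt (Finset.mem_range.1 hω)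
  | succ z ih =>
    have h1 := Finset.sum_range_succ (fun ω => (z + ω) / N) N
    rw [Finset.sum_range_succ', ih, Nat.add_div_right _ hN] at h1
    have h2 : ∑ ω ∈ Finset.range N, (z + 1 + ω) / N
        = ∑ ω ∈ Finset.range N, (z + (ω + 1)) / N :=
      Finset.sum_congr rfl fun ω _ => by congr 1; ring
    rw [h2]
    simp only [add_zero] at h1
    lia

/-- Under a uniformly random shift, two integers are separated by the grid of mesh `N` with
probability at most their distance over `N`. -/
lemma card_separated_le {N : ℕ} (hN : 0 < N) {z z' : ℕ} (hz : z ≤ z') :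
    (Finset.univ.filter fun ω : Fin N => (z + ω) / N ≠ (z' + ω) / N).card ≤ z' - z := by
  have h : (Finset.univ.filter fun ω : Fin N => (z + ω) / N ≠ (z' + ω) / N).card
      + ∑ ω : Fin N, (z + ω) / N ≤ ∑ ω : Fin N, (z' + ω) / N := by
    rw [Finset.card_filter, ← Finset.sum_add_distrib]
    refine Finset.sum_le_sum fun ω _ => ?_
    have h1 : (z + ω) / N ≤ (z' + ω) / N := Nat.div_le_div_right (by lia)
    split_ifs <;> lia
  rw [Fin.sum_univ_eq_sum_range (fun ω => (z + ω) / N),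
    Fin.sum_univ_eq_sum_range (fun ω => (z' + ω) / N), sum_range_add_div hN,
    sum_range_add_div hN] at h
  lia

/-- A reparametrization of the line at unit speed with respect to the scale `max h ε`. -/
noncomputable def scaledPos (p h : ℕ → ℝ) (ε : ℝ) (i : ℕ) : ℝ :=
  ∑ l ∈ Finset.range i, (p (l + 1) - p l) / max (h l) ε

section ScaledPos

variable {p h : ℕ → ℝ} {ε : ℝ}

lemma scaledPos_sub {i j : ℕ} (hij : i ≤ j) : scaledPos p h ε j - scaledPos p h ε i
    = ∑ l ∈ Finset.Ico i j, (p (l + 1) - p l) / max (h l) ε :=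
  (Finset.sum_Ico_eq_sub _ hij).symm

lemma scaledPos_mono (hp : Monotone p) (hε : 0 < ε) : Monotone (scaledPos p h ε) := by
  intro i j hij
  rw [← sub_nonneg, scaledPos_sub hij]
  exact Finset.sum_nonneg fun l _ =>
    div_nonneg (sub_nonneg.2 (hp (Nat.le_succ l))) (hε.le.trans (le_max_right _ _))

lemma sub_le_scaledPos_sub_mul (hp : Monotone p) (hε : 0 < ε)
    (hl : ∀ i j, |h i - h j| ≤ |p i - p j|) {i x j : ℕ} (hix : i ≤ x) (hxj : x ≤ j) :
    p j - p i
      ≤ (scaledPos p h ε j - scaledPos p h ε i) * (max (h x) ε + (p j - p i)) := by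
  have hij := hix.trans hxj
  rw [scaledPos_sub hij, Finset.sum_mul, ← Finset.sum_Ico_sub p hij]
  refine Finset.sum_le_sum fun l hlm => ?_
  rw [Finset.sum_Ico_sub p hij]
  obtain ⟨h1, h2⟩ := Finset.mem_Ico.1 hlm
  have hg : 0 < max (h l) ε := hε.trans_le (le_max_right _ _)
  have hd : |p l - p x| ≤ p j - p i := by
    have := hp h1; have := hp h2.le; have := hp hix; have := hp hxj
    rw [abs_le]; constructor <;> linarith
  have hle : max (h l) ε ≤ max (h x) ε + (p j - p i) := by
    have h3 := (le_abs_self _).trans ((hl l x).trans hd)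
    refine max_le ?_ ?_
    · linarith [le_max_left (h x) ε]
    · linarith [le_max_right (h x) ε, hp hij]
  rw [div_mul_eq_mul_div, le_div_iff₀ hg]
  exact mul_le_mul_of_nonneg_left hle (sub_nonneg.2 (hp (Nat.le_succ l)))

lemma mul_scaledPos_sub_le (hp : Monotone p) (hε : 0 < ε)
    (hl : ∀ i j, |h i - h j| ≤ |p i - p j|) {i j : ℕ} (hij : i ≤ j) (hd : p j - p i ≤ h i / 2) :
    h i * (scaledPos p h ε j - scaledPos p h ε i) ≤ 2 * (p j - p i) := by
  rw [scaledPos_sub hij, Finset.mul_sum, ← Finset.sum_Ico_sub p hij, Finset.mul_sum]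
  refine Finset.sum_le_sum fun l hlm => ?_
  obtain ⟨h1, h2⟩ := Finset.mem_Ico.1 hlm
  have hg : 0 < max (h l) ε := hε.trans_le (le_max_right _ _)
  have h3 := (le_abs_self _).trans (hl i l)
  rw [abs_sub_comm, abs_of_nonneg (sub_nonneg.2 (hp h1))] at h3
  have h4 := hp h2.le
  have h5 : h i ≤ 2 * max (h l) ε := by linarith [le_max_left (h l) ε]
  rw [mul_div_assoc', div_le_iff₀ hg]
  nlinarith [mul_le_mul_of_nonneg_right h5 (sub_nonneg.2 (hp (Nat.le_succ l)))]

end ScaledPos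

/-- A line, each point of which can be joined to an apex at a cost that is a `1`-Lipschitz
function, is randomly cut into segments so that distances are preserved up to a constant in
expectation. -/
theorem exists_random_cut {p h : ℕ → ℝ} (hp : Monotone p) (h0 : ∀ i, 0 ≤ h i)
    (hl : ∀ i j, |h i - h j| ≤ |p i - p j|) (n : ℕ) :
    ∃ (N : ℕ) (cut : Fin N → ℕ → Prop), 0 < N ∧
      (∀ ω, ∀ i ≤ n, segCost (cut ω) p h i ≤ 3 * h i) ∧
      ∀ i ≤ n, ∀ j ≤ n, ∑ ω, segDist (cut ω) p h i j ≤ N * (50 * |p i - p j|) := by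
  classical
  obtain ⟨ε, hε, hεp⟩ := exists_pos_le_sub p n
  obtain ⟨ε', hε', hεs⟩ := exists_pos_le_sub (scaledPos p h ε) n
  obtain ⟨N', hN'⟩ := exists_nat_gt (1 / ε')
  set s := scaledPos p h ε with hs
  have hsm : Monotone s := scaledPos_mono hp hε
  have hs0 : ∀ i, 0 ≤ s i := fun i => by simpa [hs, scaledPos] using hsm (Nat.zero_le i)
  obtain ⟨N, rfl⟩ : ∃ N, N = N' := ⟨N', rfl⟩
  have hNpos : (0 : ℝ) < N := (by positivity : 0 < 1 / ε').trans hN'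
  have hN : 0 < N := by exact_mod_cast hNpos
  set z : ℕ → ℕ := fun i => ⌊2 * N * s i⌋₊ with hz
  have hzm : Monotone z := fun i j hij => by
    apply Nat.floor_le_floor
    have := hsm hij
    gcongr
  set label : Fin N → ℕ → ℕ := fun ω i => (z i + ω) / N with hlabel
  have hlm : ∀ ω, Monotone (label ω) := fun ω i j hij =>
    Nat.div_le_div_right (Nat.add_le_add_right (hzm hij) _)
  set cut : Fin N → ℕ → Prop := fun ω l => label ω l ≠ label ω (l + 1) with hcut
  have hiff : ∀ ω i j, i ≤ j →
      (segRoot (cut ω) i = segRoot (cut ω) j ↔ label ω i = label ω j) := by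
    intro ω i j hij
    constructor
    · intro h
      induction j, hij using Nat.le_induction with
      | base => rfl
      | succ j hj ih =>
        have hc := not_cut_of_segRoot_eq h hj (Nat.lt_succ_self j)
        rw [segRoot_succ_of_not_cut hc] at h
        exact (ih h).trans (not_not.1 hc)
    · intro h
      refine segRoot_eq_of_not_cut hij fun l h1 h2 => not_not.2 ?_
      have := hlm ω h1; have := hlm ω h2; have := hlm ω (Nat.le_succ l)
      simp only [Nat.succ_eq_add_one] at *
      lia
  have hclose : ∀ ω i j, i ≤ j → label ω i = label ω j → s j - s i < 1 / 2 := by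
    intro ω i j _ h
    have h1 : z j < z i + N := by
      have e1 := Nat.div_add_mod (z i + ω) N
      have e2 := Nat.div_add_mod (z j + ω) N
      have e3 := Nat.mod_lt (z j + ω) hN
      have h' : (z i + ω) / N = (z j + ω) / N := h
      rw [h'] at e1
      lia
    have h2 : (z j : ℝ) + 1 ≤ z i + N := by exact_mod_cast h1
    have h3 : 2 * N * s j < z j + 1 := Nat.lt_floor_add_one _
    have h4 : (z i : ℝ) ≤ 2 * N * s i :=
      Nat.floor_le (mul_nonneg (by positivity) (hs0 i))
    by_contra hcon
    push Not at hcon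
    nlinarith
  have hcost : ∀ ω, ∀ i ≤ n, segCost (cut ω) p h i ≤ 3 * h i := by
    intro ω i hi
    set r := segRoot (cut ω) i with hr
    have hri : r ≤ i := segRoot_le i
    have hlab := (hiff ω r i hri).1 (segRoot_segRoot i)
    have hS := hclose ω r i hri hlab
    have hd := sub_le_scaledPos_sub_mul hp hε hl hri le_rfl
    rw [← hs] at hd
    have hd0 : 0 ≤ p i - p r := sub_nonneg.2 (hp hri)
    have hg : 0 < max (h i) ε := hε.trans_le (le_max_right _ _)
    have hlt : p i - p r < max (h i) ε := by
      by_contra hcon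
      push Not at hcon
      nlinarith
    have hle : p i - p r ≤ h i := by
      rcases lt_max_iff.1 hlt with hlt | hlt
      · exact hlt.le
      · by_contra hcon
        push Not at hcon
        exact absurd (hεp r (hri.trans hi) i hi ((h0 i).trans_lt hcon)) (not_le.2 hlt)
    have h3 := (le_abs_self _).trans (hl r i)
    rw [abs_sub_comm, abs_of_nonneg hd0] at h3
    simp only [segCost, ← hr]
    linarith
  have hmain : ∀ i ≤ n, ∀ j ≤ n, i ≤ j →
      ∑ ω, segDist (cut ω) p h i j ≤ N * (50 * |p i - p j|) := by
    intro i hi j hj hij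
    have hd0 : 0 ≤ p j - p i := sub_nonneg.2 (hp hij)
    have hhj := (le_abs_self _).trans (hl j i)
    rw [abs_of_nonneg hd0] at hhj
    rw [abs_sub_comm, abs_of_nonneg hd0]
    by_cases hcase : p j - p i ≤ h i / 2
    · have hterm : ∀ ω, segDist (cut ω) p h i j ≤ (p j - p i)
          + (if label ω i ≠ label ω j then (1 : ℝ) else 0) * (15 / 2 * h i) := by
        intro ω
        rw [segDist]
        simp only [hiff ω i j hij]
        by_cases hlab : label ω i = label ω j
        · simp [hlab, abs_sub_comm (p i), abs_of_nonneg hd0]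
        · simp only [hlab, if_false, ne_eq, not_false_eq_true, if_true, one_mul]
          linarith [hcost ω i hi, hcost ω j hj]
      refine (Finset.sum_le_sum fun ω _ => hterm ω).trans ?_
      rw [Finset.sum_add_distrib, ← Finset.sum_mul, Finset.sum_boole, Finset.sum_const,
        Finset.card_univ, Fintype.card_fin, nsmul_eq_mul]
      set K := (Finset.univ.filter fun ω => label ω i ≠ label ω j).card with hK
      have hK1 : (K : ℝ) ≤ z j - z i := by
        rw [← Nat.cast_sub (hzm hij)]
        exact_mod_cast card_separated_le hN (hzm hij)
      have hK2 : (K : ℝ) ≤ 3 * N * (s j - s i) := by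
        rcases (hsm hij).eq_or_lt with heq | hlt
        · have : z j = z i := by simp only [hz, heq]
          rw [heq, sub_self, mul_zero]
          simpa [this] using hK1
        · have h1 := hεs i hi j hj (sub_pos.2 hlt)
          have h2 : 1 ≤ N * (s j - s i) := by
            have h5 := (div_lt_iff₀ hε').1 hN'
            nlinarith
          have h3 : (z j : ℝ) ≤ 2 * N * s j :=
            Nat.floor_le (mul_nonneg (by positivity) (hs0 j))
          have h4 : 2 * N * s i < z i + 1 := Nat.lt_floor_add_one _
          linarith
      have hK3 := mul_scaledPos_sub_le hp hε hl hij hcase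
      rw [← hs] at hK3
      have hK4 : (K : ℝ) * (15 / 2 * h i) ≤ N * (45 * (p j - p i)) :=
        calc (K : ℝ) * (15 / 2 * h i) ≤ 3 * N * (s j - s i) * (15 / 2 * h i) :=
              mul_le_mul_of_nonneg_right hK2 (mul_nonneg (by norm_num) (h0 i))
          _ = N * (45 / 2 * (h i * (s j - s i))) := by ring
          _ ≤ N * (45 / 2 * (2 * (p j - p i))) := by gcongr
          _ = N * (45 * (p j - p i)) := by ring
      have := mul_nonneg hNpos.le hd0
      linarith
    · push Not at hcase
      have hterm : ∀ ω ∈ Finset.univ, segDist (cut ω) p h i j ≤ 50 * (p j - p i) := by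
        intro ω _
        rw [segDist]
        split_ifs
        · rw [abs_sub_comm, abs_of_nonneg hd0]; linarith
        · linarith [hcost ω i hi, hcost ω j hj]
      refine (Finset.sum_le_card_nsmul _ _ _ hterm).trans ?_
      rw [Finset.card_univ, Fintype.card_fin, nsmul_eq_mul]
  refine ⟨N, cut, hN, hcost, fun i hi j hj => ?_⟩
  rcases le_total i j with hij | hij
  · exact hmain i hi j hj hij
  · have := hmain j hj i hi hij
    rw [abs_sub_comm]
    refine le_of_eq_of_le (Finset.sum_congr rfl fun ω _ => ?_) this
    simp only [segDist]
    by_cases hc : segRoot (cut ω) i = segRoot (cut ω) j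
    · simp [hc, abs_sub_comm]
    · rw [if_neg hc, if_neg (Ne.symm hc), add_comm]

end RandomCut

section Separator

variable {V : Type} (S : Finset V) (α β : V → ℕ)

/-- The intersection graph of the intervals `[α v, β v]`, `v ∈ S`, in which moreover intervals
bounding a gap of their union are joined. -/
def gapGraph : SimpleGraph V where
  Adj u v := u ≠ v ∧ u ∈ S ∧ v ∈ S ∧ ((α u ≤ β v ∧ α v ≤ β u) ∨
    (β u < α v ∧ ∀ w ∈ S, β w ≤ β u ∨ α v ≤ α w) ∨
    (β v < α u ∧ ∀ w ∈ S, β w ≤ β v ∨ α u ≤ α w))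
  symm := ⟨by rintro u v ⟨h1, h2, h3, h4⟩; exact ⟨h1.symm, h3, h2, by tauto⟩⟩
  loopless := ⟨fun _ h => h.1 rfl⟩

variable {S α β}

lemma gapGraph_reachable {s : V} (hs : s ∈ S) (hmin : ∀ v ∈ S, α s ≤ α v)
    (hαβ : ∀ v ∈ S, α v ≤ β v) {v : V} (hv : v ∈ S) : (gapGraph S α β).Reachable v s := by
  classical
  by_contra hcon
  obtain ⟨v, hvm, hvmin⟩ := Finset.exists_min_image
    (S.filter fun v => ¬ (gapGraph S α β).Reachable v s) α
    ⟨v, Finset.mem_filter.2 ⟨hv, hcon⟩⟩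
  obtain ⟨hv, hvr⟩ := Finset.mem_filter.1 hvm
  obtain ⟨u, hum, humax⟩ := Finset.exists_max_image
    (S.filter fun u => (gapGraph S α β).Reachable u s ∧ α u ≤ α v) β
    ⟨s, Finset.mem_filter.2 ⟨hs, SimpleGraph.Reachable.refl s, hmin v hv⟩⟩
  obtain ⟨hu, hur, huv⟩ := Finset.mem_filter.1 hum
  have hne : v ≠ u := by rintro rfl; exact hvr hur
  refine hvr (SimpleGraph.Reachable.trans (SimpleGraph.Adj.reachable ?_) hur)
  refine ⟨hne, hv, hu, ?_⟩
  by_cases hlt : α v ≤ β u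
  · exact Or.inl ⟨hlt, huv.trans (hαβ v hv)⟩
  refine Or.inr (Or.inr ⟨not_le.1 hlt, fun w hw => ?_⟩)
  by_contra hcon
  push Not at hcon
  have hwr : (gapGraph S α β).Reachable w s := by
    by_contra hwr
    exact absurd (hvmin w (Finset.mem_filter.2 ⟨hw, hwr⟩)) (not_le.2 hcon.2)
  exact absurd (humax w (Finset.mem_filter.2 ⟨hw, hwr, hcon.2.le⟩)) (not_le.2 hcon.1)

lemma gapGraph_getVert_mem {u s : V} (w : (gapGraph S α β).Walk u s) (hu : u ∈ S) (i : ℕ) :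
    w.getVert i ∈ S := by
  induction w generalizing i with
  | nil => simpa using hu
  | cons h p ih =>
    cases i with
    | zero => simpa using hu
    | succ i => simpa using ih h.2.2.1 i

lemma gapGraph_walk_hits (hαβ : ∀ v ∈ S, α v ≤ β v) {u s x : V} (w : (gapGraph S α β).Walk u s)
    {t : ℕ}
    (hx : x ∈ S) (hxt : α x ≤ t) (htx : t ≤ β x) (hs : α s ≤ t) (hu : t ≤ β u) :
    ∃ i ≤ w.length, α (w.getVert i) ≤ t ∧ t ≤ β (w.getVert i) := by
  induction w with
  | nil => exact ⟨0, le_rfl, by simpa using hs, by simpa using hu⟩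
  | @cons u v s h p ih =>
    by_cases hut : α u ≤ t
    · exact ⟨0, Nat.zero_le _, by simpa using hut, by simpa using hu⟩
    · have hv : t ≤ β v := by
        obtain ⟨-, -, h3, h4⟩ := h
        have := hαβ v h3
        by_contra hcon
        rcases h4 with h4 | ⟨h4, -⟩ | ⟨-, h4⟩
        · lia
        · lia
        · have := h4 x hx
          lia
      obtain ⟨i, hi, hi1, hi2⟩ := ih hs hv
      exact ⟨i + 1, by simpa using hi, by simpa using hi1, by simpa using hi2⟩

lemma gapGraph_geodesic [Finite V] {δ : V → V → ℝ} (hδ : IsPseudometric δ) {u s : V}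
    (hS : ∀ v ∈ S, (gapGraph S α β).Reachable v s) (w : (gapGraph S α β).Walk u s)
    (hw : (w.edges.map (edgeLength δ hδ.symm)).sum
      = spDist (gapGraph S α β) (edgeLength δ hδ.symm) u s) {i j : ℕ} (hij : i ≤ j) :
    δ (w.getVert i) (w.getVert j)
      ≤ spDist (gapGraph S α β) (edgeLength δ hδ.symm) (w.getVert i) s
        - spDist (gapGraph S α β) (edgeLength δ hδ.symm) (w.getVert j) s := by
  have hl : ∀ e, 0 ≤ edgeLength δ hδ.symm e := fun e => by
    induction e using Sym2.inductionOn with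
    | _ x y => exact hδ.nonneg x y
  induction w generalizing i j with
  | nil => simp [hδ.self]
  | @cons u v s h p ih =>
    have h1 := spDist_le_add_of_adj hl h (hS v h.2.2.1)
    have h2 := spDist_le_walk hl p
    simp only [SimpleGraph.Walk.edges_cons, List.map_cons, List.sum_cons] at hw
    have hp : (p.edges.map (edgeLength δ hδ.symm)).sum
      = spDist (gapGraph S α β) (edgeLength δ hδ.symm) v s := by linarith
    have huv : edgeLength δ hδ.symm s(u, v) = δ u v := rfl
    cases i with
    | zero =>
      cases j with
      | zero => simp [hδ.self]
      | succ j =>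
        have h3 := ih hS hp (Nat.zero_le j)
        have h4 := hδ.triangle u v (p.getVert j)
        simp only [SimpleGraph.Walk.getVert_zero, SimpleGraph.Walk.getVert_cons_succ] at h3 ⊢
        linarith
    | succ i =>
      cases j with
      | zero => lia
      | succ j => simpa using ih hS hp (Nat.le_of_succ_le_succ hij)

/-- Among finitely many intervals there is a sequence of intervals meeting every point of their
union and forming a geodesic for a pseudometric that dominates a given one and agrees with it on
intersecting pairs of intervals. -/
theorem exists_geodesic_separator [Finite V] {δ : V → V → ℝ} (hδ : IsPseudometric δ)
    (hS : S.Nonempty) (hαβ : ∀ v ∈ S, α v ≤ β v) :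
    ∃ (n : ℕ) (q : ℕ → V) (pos : V → ℝ), (∀ i, q i ∈ S) ∧ Set.InjOn q {i | i ≤ n} ∧
      Monotone (fun i => pos (q i)) ∧
      (∀ u ∈ S, ∀ v ∈ S, α u ≤ β v → α v ≤ β u → |pos u - pos v| ≤ δ u v) ∧
      (∀ i j, δ (q i) (q j) ≤ |pos (q i) - pos (q j)|) ∧
      (∀ i, n ≤ i → q i = q n) ∧
      ∀ t, ∀ x ∈ S, α x ≤ t → t ≤ β x → ∃ i ≤ n, α (q i) ≤ t ∧ t ≤ β (q i) := by
  obtain ⟨s, hs, hsmin⟩ := Finset.exists_min_image S α hS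
  obtain ⟨e, he, hemax⟩ := Finset.exists_max_image S β hS
  have hreach : ∀ v ∈ S, (gapGraph S α β).Reachable v s := fun v hv =>
    gapGraph_reachable hs hsmin hαβ hv
  have hl : ∀ e, 0 ≤ edgeLength δ hδ.symm e := fun e => by
    induction e using Sym2.inductionOn with
    | _ x y => exact hδ.nonneg x y
  obtain ⟨w, hwp, hw⟩ := exists_path_length_eq_spDist hl (hreach e he)
  have hgeo := fun {i j : ℕ} (hij : i ≤ j) => gapGraph_geodesic hδ hreach w hw hij
  refine ⟨w.length, w.getVert, fun v => - spDist (gapGraph S α β) (edgeLength δ hδ.symm) v s,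
    gapGraph_getVert_mem w he, hwp.getVert_injOn, ?_, ?_, ?_,
    fun i hi => by rw [w.getVert_of_length_le hi, w.getVert_length], ?_⟩
  · intro i j hij
    have := hgeo hij
    have := hδ.nonneg (w.getVert i) (w.getVert j)
    simp only
    linarith
  · intro u hu v hv h1 h2
    rcases eq_or_ne u v with rfl | hne
    · simp [hδ.self]
    have hadj : (gapGraph S α β).Adj u v := ⟨hne, hu, hv, Or.inl ⟨h1, h2⟩⟩
    have h3 := spDist_le_add_of_adj hl hadj (hreach v hv)
    have h4 := spDist_le_add_of_adj hl hadj.symm (hreach u hu)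
    have h5 : edgeLength δ hδ.symm s(u, v) = δ u v := rfl
    have h6 : edgeLength δ hδ.symm s(v, u) = δ u v := hδ.symm v u
    rw [abs_le]
    constructor <;> linarith
  · intro i j
    rcases le_total i j with hij | hij
    · have h1 := hgeo hij
      refine h1.trans ((le_abs_self _).trans_eq ?_)
      rw [abs_sub_comm]
      congr 1; ring
    · have h1 := hgeo hij
      rw [hδ.symm]
      refine h1.trans ((le_abs_self _).trans_eq ?_)
      congr 1; ring
  · intro t x hx h1 h2
    exact gapGraph_walk_hits hαβ w hx h1 h2 ((hsmin x hx).trans h1) (h2.trans (hemax x hx))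

end Separator

section ApexTree

/-- Combinatorial data of a rooted forest whose roots are joined to an apex: parents, roots,
distances to the apex, distances inside the components, and an interval representation witnessing
a path decomposition of the forest. -/
structure ApexTree (V : Type) where
  par : V → V
  root : V → V
  cost : V → ℝ
  dist : V → V → ℝ
  lo : V → ℕ
  hi : V → ℕ

variable {V : Type}

namespace ApexTree

open Classical in
/-- The distance between two vertices in the tree obtained from the forest by adding the apex. -/
noncomputable def length (T : ApexTree V) (u v : V) : ℝ :=
  if T.root u = T.root v then T.dist u v else T.cost u + T.cost v

/-- `T` is a forest on `S` of pathwidth less than `m`; when the edges have lengths given by `δ` and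
the roots are joined to the apex at cost `h`, its distances are at most those recorded in `T`. -/
structure Spans (T : ApexTree V) (S : Finset V) (δ : V → V → ℝ) (h : V → ℝ) (m : ℕ) :
    Prop where
  par_mem : ∀ x ∈ S, T.par x ∈ S
  root_mem : ∀ x ∈ S, T.root x ∈ S
  par_root : ∀ x ∈ S, T.par (T.root x) = T.root x
  root_root : ∀ x ∈ S, T.root (T.root x) = T.root x
  root_par : ∀ x ∈ S, T.root (T.par x) = T.root x
  cost_ge : ∀ c, IsPseudometric c → (∀ x ∈ S, c x (T.par x) ≤ δ x (T.par x)) →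
    ∀ x ∈ S, c x (T.root x) + h (T.root x) ≤ T.cost x
  dist_ge : ∀ c, IsPseudometric c → (∀ x ∈ S, c x (T.par x) ≤ δ x (T.par x)) →
    ∀ u ∈ S, ∀ v ∈ S, T.root u = T.root v → c u v ≤ T.dist u v
  lo_le_hi : ∀ x ∈ S, T.lo x ≤ T.hi x
  lo_le_hi_par : ∀ x ∈ S, T.lo x ≤ T.hi (T.par x) ∧ T.lo (T.par x) ≤ T.hi x
  card_le : ∀ t, (S.filter fun x => T.lo x ≤ t ∧ t ≤ T.hi x).card ≤ m

lemma Spans.root_le_cost {T : ApexTree V} {S : Finset V} {δ : V → V → ℝ} {h : V → ℝ} {m : ℕ}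
    (hT : T.Spans S δ h m) (hδ : IsPseudometric δ) {x : V} (hx : x ∈ S) :
    h (T.root x) ≤ T.cost x := by
  simpa using hT.cost_ge _ IsPseudometric.zero (fun _ _ => hδ.nonneg _ _) x hx

lemma Spans.dist_nonneg {T : ApexTree V} {S : Finset V} {δ : V → V → ℝ} {h : V → ℝ} {m : ℕ}
    (hT : T.Spans S δ h m) (hδ : IsPseudometric δ) {u v : V} (hu : u ∈ S) (hv : v ∈ S)
    (huv : T.root u = T.root v) : 0 ≤ T.dist u v :=
  hT.dist_ge _ IsPseudometric.zero (fun _ _ => hδ.nonneg _ _) u hu v hv huv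

end ApexTree

/-- The set `S` is covered by a geodesic `q 0, …, q n` and by the remaining set `S'`; the function
`near` gives the closest point of the geodesic. -/
structure GeodesicSplit (S S' : Finset V) (ρ : V → V → ℝ) (pos : V → ℝ) (n : ℕ) (q : ℕ → V)
    (idx near : V → ℕ) : Prop where
  pseudometric : IsPseudometric ρ
  subset : S' ⊆ S
  q_mem : ∀ i, q i ∈ S
  q_notMem : ∀ i, q i ∉ S'
  idx_le : ∀ x ∈ S, x ∉ S' → idx x ≤ n
  q_idx : ∀ x ∈ S, x ∉ S' → q (idx x) = x
  idx_q : ∀ i ≤ n, idx (q i) = i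
  near_le : ∀ x, near x ≤ n
  rho_near_le : ∀ x, ∀ i ≤ n, ρ x (q (near x)) ≤ ρ x (q i)
  mono : Monotone fun i => pos (q i)
  rho_q : ∀ i j, ρ (q i) (q j) = |pos (q i) - pos (q j)|

section Graft

variable (S' : Finset V) (ρ : V → V → ℝ) (h : V → ℝ) (pos : V → ℝ) (q : ℕ → V)
  (idx near : V → ℕ) (T' : ApexTree V)

open Classical in
/-- The index of the vertex of the geodesic to which the component of a vertex is closest. -/
noncomputable def graftBase (x : V) : ℕ := if x ∈ S' then near (T'.root x) else idx x

/-- Whether a vertex is connected to the apex through the geodesic. -/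
def graftFlag (x : V) : Prop :=
  x ∈ S' → ρ (T'.root x) (q (near (T'.root x))) < h (T'.root x)

open Classical in
/-- The distance from a vertex to the geodesic or the apex. -/
noncomputable def graftExtra (x : V) : ℝ := if x ∈ S' then T'.cost x else 0

open Classical in
/-- The forest obtained from a cut geodesic and a forest on the complement of the geodesic by
joining each root of the latter to the geodesic when this is cheaper than joining it to the
apex. -/
noncomputable def graft (L : ℕ) (cut : ℕ → Prop) : ApexTree V where
  par x := if x ∈ S' then
      (if T'.root x = x then (if ρ x (q (near x)) < h x then q (near x) else x) else T'.par x)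
    else if segRoot cut (idx x) = idx x then x else q (idx x - 1)
  root x := if graftFlag S' ρ h q near T' x then q (segRoot cut (graftBase S' idx near T' x))
    else T'.root x
  cost x := graftExtra S' T' x + if graftFlag S' ρ h q near T' x then
    segCost cut (fun i => pos (q i)) (fun i => h (q i)) (graftBase S' idx near T' x) else 0
  dist u v := if u ∈ S' ∧ v ∈ S' ∧ T'.root u = T'.root v then T'.dist u v else
    graftExtra S' T' u + graftExtra S' T' v
      + |pos (q (graftBase S' idx near T' u)) - pos (q (graftBase S' idx near T' v))|
  lo x := if x ∈ S' then near (T'.root x) * L + 1 + T'.lo x else idx x * L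
  hi x := if x ∈ S' then near (T'.root x) * L + 1 + T'.hi x else (idx x + 1) * L

variable {S' ρ h pos q idx near T'} {S : Finset V} {n m L : ℕ} {cut : ℕ → Prop}
  {δ : V → V → ℝ}

lemma graftBase_le (hG : GeodesicSplit S S' ρ pos n q idx near) {x : V} (hx : x ∈ S) :
    graftBase S' idx near T' x ≤ n := by
  rw [graftBase]
  split_ifs with h1
  · exact hG.near_le _
  · exact hG.idx_le x hx h1

lemma q_inj (hG : GeodesicSplit S S' ρ pos n q idx near) {i j : ℕ} (hi : i ≤ n) (hj : j ≤ n)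
    (hij : q i = q j) : i = j := by
  rw [← hG.idx_q i hi, ← hG.idx_q j hj, hij]

lemma dist_graft_base_le (hG : GeodesicSplit S S' ρ pos n q idx near)
    (hT : T'.Spans S' ρ (fun x => min (h x) (ρ x (q (near x)))) m)
    {c : V → V → ℝ} (hc : IsPseudometric c) (hcT : ∀ x ∈ S', c x (T'.par x) ≤ ρ x (T'.par x))
    (hcr : ∀ x ∈ S', T'.root x = x → ρ x (q (near x)) < h x →
      c x (q (near x)) ≤ ρ x (q (near x)))
    {x : V} (hx : x ∈ S) (hf : graftFlag S' ρ h q near T' x) :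
    c x (q (graftBase S' idx near T' x)) ≤ graftExtra S' T' x := by
  rw [graftBase, graftExtra]
  split_ifs with h1
  · have h2 := hT.cost_ge c hc hcT x h1
    have h3 := hf h1
    have h4 := hcr _ (hT.root_mem x h1) (hT.root_root x h1) h3
    simp only [min_eq_right h3.le] at h2
    linarith [hc.triangle x (T'.root x) (q (near (T'.root x)))]
  · rw [hG.q_idx x hx h1, hc.self]

lemma rho_graft_base_le (hG : GeodesicSplit S S' ρ pos n q idx near)
    (hT : T'.Spans S' ρ (fun x => min (h x) (ρ x (q (near x)))) m)
    {x : V} (hx : x ∈ S) (hf : graftFlag S' ρ h q near T' x) :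
    ρ x (q (graftBase S' idx near T' x)) ≤ graftExtra S' T' x :=
  dist_graft_base_le hG hT hG.pseudometric (fun _ _ => le_rfl) (fun _ _ _ _ => le_rfl) hx hf

lemma le_graftExtra_of_not_flag (hG : GeodesicSplit S S' ρ pos n q idx near)
    (hT : T'.Spans S' ρ (fun x => min (h x) (ρ x (q (near x)))) m)
    (hh : ∀ x y, |h x - h y| ≤ ρ x y) {x : V} (hf : ¬ graftFlag S' ρ h q near T' x) :
    x ∈ S' ∧ h x ≤ graftExtra S' T' x := by
  rw [graftFlag, Classical.not_imp] at hf
  obtain ⟨h1, h2⟩ := hf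
  refine ⟨h1, ?_⟩
  have h3 := hT.cost_ge ρ hG.pseudometric (fun _ _ => le_rfl) x h1
  simp only [min_eq_left (not_lt.1 h2)] at h3
  rw [graftExtra, if_pos h1]
  linarith [(le_abs_self _).trans (hh x (T'.root x))]

lemma graftExtra_nonneg (hG : GeodesicSplit S S' ρ pos n q idx near)
    (hT : T'.Spans S' ρ (fun x => min (h x) (ρ x (q (near x)))) m) (h0 : ∀ x, 0 ≤ h x) (x : V) :
    0 ≤ graftExtra S' T' x := by
  rw [graftExtra]
  split_ifs with h1
  · exact (le_min (h0 _) (hG.pseudometric.nonneg _ _)).trans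
      (hT.root_le_cost hG.pseudometric h1)
  · exact le_rfl

lemma graft_par_q (hG : GeodesicSplit S S' ρ pos n q idx near) {j : ℕ} (hj : j + 1 ≤ n)
    (hcut : ¬ cut j) : (graft S' ρ h pos q idx near T' L cut).par (q (j + 1)) = q j := by
  have h1 := segRoot_le (cut := cut) j
  have h2 := segRoot_succ_of_not_cut hcut
  have h3 : segRoot cut (j + 1) ≠ j + 1 := by lia
  simp [graft, hG.q_notMem, hG.idx_q _ hj, h3]

lemma graft_dist_q_le (hG : GeodesicSplit S S' ρ pos n q idx near)
    {c : V → V → ℝ} (hc : IsPseudometric c)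
    (hcp : ∀ x ∈ S, c x ((graft S' ρ h pos q idx near T' L cut).par x)
      ≤ ρ x ((graft S' ρ h pos q idx near T' L cut).par x))
    {i j : ℕ} (hij : i ≤ j) (hj : j ≤ n) (hr : segRoot cut i = segRoot cut j) :
    c (q j) (q i) ≤ pos (q j) - pos (q i) := by
  induction j, hij using Nat.le_induction with
  | base => simp [hc.self]
  | succ j hij ih =>
    have hcut := not_cut_of_segRoot_eq hr hij (Nat.lt_succ_self j)
    rw [segRoot_succ_of_not_cut hcut] at hr
    have h1 := ih (by lia) hr
    have h2 := hcp (q (j + 1)) (hG.q_mem _)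
    have h3 : pos (q j) ≤ pos (q (j + 1)) := hG.mono (Nat.le_succ j)
    rw [graft_par_q hG hj hcut, hG.rho_q, abs_of_nonneg (sub_nonneg.2 h3)] at h2
    linarith [hc.triangle (q (j + 1)) (q j) (q i)]

lemma graft_dist_q_le_abs (hG : GeodesicSplit S S' ρ pos n q idx near)
    {c : V → V → ℝ} (hc : IsPseudometric c)
    (hcp : ∀ x ∈ S, c x ((graft S' ρ h pos q idx near T' L cut).par x)
      ≤ ρ x ((graft S' ρ h pos q idx near T' L cut).par x))
    {i j : ℕ} (hi : i ≤ n) (hj : j ≤ n) (hr : segRoot cut i = segRoot cut j) :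
    c (q i) (q j) ≤ |pos (q i) - pos (q j)| := by
  rcases le_total i j with hij | hij
  · rw [hc.symm, abs_sub_comm]
    exact (graft_dist_q_le hG hc hcp hij hj hr).trans (le_abs_self _)
  · exact (graft_dist_q_le hG hc hcp hij hi hr.symm).trans (le_abs_self _)

lemma graftFlag_q (hG : GeodesicSplit S S' ρ pos n q idx near) (i : ℕ) :
    graftFlag S' ρ h q near T' (q i) := fun hi => absurd hi (hG.q_notMem i)

lemma graftBase_q (hG : GeodesicSplit S S' ρ pos n q idx near) {i : ℕ} (hi : i ≤ n) :
    graftBase S' idx near T' (q i) = i := by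
  rw [graftBase, if_neg (hG.q_notMem i), hG.idx_q i hi]

lemma graft_root_q (hG : GeodesicSplit S S' ρ pos n q idx near) {i : ℕ} (hi : i ≤ n) :
    (graft S' ρ h pos q idx near T' L cut).root (q i) = q (segRoot cut i) := by
  simp only [graft]
  rw [if_pos (graftFlag_q hG i), graftBase_q hG hi]

lemma graft_root_of_flag {x : V} (hf : graftFlag S' ρ h q near T' x) :
    (graft S' ρ h pos q idx near T' L cut).root x
      = q (segRoot cut (graftBase S' idx near T' x)) := by
  simp only [graft]
  rw [if_pos hf]

lemma graft_root_of_not_flag {x : V} (hf : ¬ graftFlag S' ρ h q near T' x) :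
    (graft S' ρ h pos q idx near T' L cut).root x = T'.root x := by
  simp only [graft]
  rw [if_neg hf]

lemma mem_of_not_graftFlag {x : V} (hf : ¬ graftFlag S' ρ h q near T' x) : x ∈ S' := by
  by_contra hx
  exact hf fun hx' => absurd hx' hx

lemma graft_root_eq_of_mem {x y : V} (hx : x ∈ S') (hy : y ∈ S') (hxy : T'.root x = T'.root y) :
    (graft S' ρ h pos q idx near T' L cut).root x
      = (graft S' ρ h pos q idx near T' L cut).root y := by
  simp [graft, graftFlag, graftBase, hx, hy, hxy]

lemma graft_root_ne (hG : GeodesicSplit S S' ρ pos n q idx near)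
    (hT : T'.Spans S' ρ (fun x => min (h x) (ρ x (q (near x)))) m) {x y : V}
    (hx : graftFlag S' ρ h q near T' x) (hy : ¬ graftFlag S' ρ h q near T' y) :
    (graft S' ρ h pos q idx near T' L cut).root x
      ≠ (graft S' ρ h pos q idx near T' L cut).root y := by
  rw [graft_root_of_flag hx, graft_root_of_not_flag hy]
  intro heq
  exact hG.q_notMem _ (heq ▸ hT.root_mem y (mem_of_not_graftFlag hy))

/-- The possible parents of a vertex in the grafted forest. -/
lemma graft_par_cases (hG : GeodesicSplit S S' ρ pos n q idx near) {x : V} (hx : x ∈ S) :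
    (x ∉ S' ∧ (graft S' ρ h pos q idx near T' L cut).par x = x) ∨
    (∃ j, j + 1 ≤ n ∧ ¬ cut j ∧ x = q (j + 1) ∧
      (graft S' ρ h pos q idx near T' L cut).par x = q j) ∨
    (x ∈ S' ∧ T'.root x = x ∧ ¬ ρ x (q (near x)) < h x ∧
      (graft S' ρ h pos q idx near T' L cut).par x = x) ∨
    (x ∈ S' ∧ T'.root x = x ∧ ρ x (q (near x)) < h x ∧
      (graft S' ρ h pos q idx near T' L cut).par x = q (near x)) ∨
    (x ∈ S' ∧ T'.root x ≠ x ∧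
      (graft S' ρ h pos q idx near T' L cut).par x = T'.par x) := by
  by_cases hx' : x ∈ S'
  · by_cases hr : T'.root x = x
    · by_cases ha : ρ x (q (near x)) < h x
      · refine Or.inr (Or.inr (Or.inr (Or.inl ⟨hx', hr, ha, ?_⟩)))
        simp [graft, hx', hr, ha]
      · refine Or.inr (Or.inr (Or.inl ⟨hx', hr, ha, ?_⟩))
        simp [graft, hx', hr, ha]
    · refine Or.inr (Or.inr (Or.inr (Or.inr ⟨hx', hr, ?_⟩)))
      simp [graft, hx', hr]
  · by_cases hs : segRoot cut (idx x) = idx x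
    · exact Or.inl ⟨hx', by simp [graft, hx', hs]⟩
    · have hq := hG.q_idx x hx hx'
      have hn := hG.idx_le x hx hx'
      obtain ⟨j, hj⟩ : ∃ j, idx x = j + 1 :=
        Nat.exists_eq_succ_of_ne_zero fun h0 => hs (by rw [h0]; rfl)
      refine Or.inr (Or.inl ⟨j, by lia, fun hcut => hs ?_, by rw [← hj, hq], ?_⟩)
      · rw [hj, segRoot_succ_of_cut hcut]
      · simp only [graft]
        rw [if_neg hx', if_neg hs, hj, Nat.add_sub_cancel]

lemma graft_comp_le (hG : GeodesicSplit S S' ρ pos n q idx near)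
    (hT : T'.Spans S' ρ (fun x => min (h x) (ρ x (q (near x)))) m) {c : V → V → ℝ}
    (hc : IsPseudometric c)
    (hcp : ∀ x ∈ S, c x ((graft S' ρ h pos q idx near T' L cut).par x)
      ≤ ρ x ((graft S' ρ h pos q idx near T' L cut).par x)) :
    (∀ x ∈ S', c x (T'.par x) ≤ ρ x (T'.par x)) ∧
    ∀ x ∈ S', T'.root x = x → ρ x (q (near x)) < h x → c x (q (near x)) ≤ ρ x (q (near x)) := by
  refine ⟨fun x hx => ?_, fun x hx hr ha => ?_⟩
  · by_cases hr : T'.root x = x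
    · have h1 := hT.par_root x hx
      rw [hr] at h1
      rw [h1, hc.self]
      exact hG.pseudometric.nonneg _ _
    · have h1 := hcp x (hG.subset hx)
      simpa [graft, hx, hr] using h1
  · have h1 := hcp x (hG.subset hx)
    simpa [graft, hx, hr, ha] using h1

lemma graft_cost_ge (hG : GeodesicSplit S S' ρ pos n q idx near)
    (hT : T'.Spans S' ρ (fun x => min (h x) (ρ x (q (near x)))) m) {c : V → V → ℝ}
    (hc : IsPseudometric c)
    (hcp : ∀ x ∈ S, c x ((graft S' ρ h pos q idx near T' L cut).par x)
      ≤ ρ x ((graft S' ρ h pos q idx near T' L cut).par x)) {x : V} (hx : x ∈ S) :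
    c x ((graft S' ρ h pos q idx near T' L cut).root x)
      + h ((graft S' ρ h pos q idx near T' L cut).root x)
      ≤ (graft S' ρ h pos q idx near T' L cut).cost x := by
  obtain ⟨hcT, hcr⟩ := graft_comp_le hG hT hc hcp
  by_cases hf : graftFlag S' ρ h q near T' x
  · have hB := graftBase_le (T' := T') hG hx
    have h1 := dist_graft_base_le hG hT hc hcT hcr hx hf
    have h2 := graft_dist_q_le hG hc hcp (segRoot_le (cut := cut) _) hB (segRoot_segRoot _)
    have h3 := hc.triangle x (q (graftBase S' idx near T' x))
      (q (segRoot cut (graftBase S' idx near T' x)))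
    rw [graft_root_of_flag hf]
    simp only [graft, segCost]
    rw [if_pos hf]
    linarith
  · have hx' := mem_of_not_graftFlag hf
    have h1 := hT.cost_ge c hc hcT x hx'
    have h2 : ¬ ρ (T'.root x) (q (near (T'.root x))) < h (T'.root x) := fun h2 => hf fun _ => h2
    rw [graft_root_of_not_flag hf]
    simp only [graft, graftExtra]
    rw [if_neg hf, if_pos hx', add_zero]
    simpa only [min_eq_left (not_lt.1 h2)] using h1

lemma graft_dist_ge (hG : GeodesicSplit S S' ρ pos n q idx near)
    (hT : T'.Spans S' ρ (fun x => min (h x) (ρ x (q (near x)))) m) {c : V → V → ℝ}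
    (hc : IsPseudometric c)
    (hcp : ∀ x ∈ S, c x ((graft S' ρ h pos q idx near T' L cut).par x)
      ≤ ρ x ((graft S' ρ h pos q idx near T' L cut).par x)) {u v : V} (hu : u ∈ S) (hv : v ∈ S)
    (huv : (graft S' ρ h pos q idx near T' L cut).root u
      = (graft S' ρ h pos q idx near T' L cut).root v) :
    c u v ≤ (graft S' ρ h pos q idx near T' L cut).dist u v := by
  obtain ⟨hcT, hcr⟩ := graft_comp_le hG hT hc hcp
  simp only [graft]
  split_ifs with hs
  · exact hT.dist_ge c hc hcT u hs.1 v hs.2.1 hs.2.2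
  by_cases hfu : graftFlag S' ρ h q near T' u
  · by_cases hfv : graftFlag S' ρ h q near T' v
    · have hBu := graftBase_le (T' := T') hG hu
      have hBv := graftBase_le (T' := T') hG hv
      rw [graft_root_of_flag hfu, graft_root_of_flag hfv] at huv
      have hr := q_inj hG ((segRoot_le _).trans hBu) ((segRoot_le _).trans hBv) huv
      have h1 := dist_graft_base_le hG hT hc hcT hcr hu hfu
      have h2 := dist_graft_base_le hG hT hc hcT hcr hv hfv
      have h3 := graft_dist_q_le_abs hG hc hcp hBu hBv hr
      rw [hc.symm] at h2
      linarith [hc.triangle u (q (graftBase S' idx near T' u)) v,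
        hc.triangle (q (graftBase S' idx near T' u)) (q (graftBase S' idx near T' v)) v]
    · exact absurd huv (graft_root_ne hG hT hfu hfv)
  · by_cases hfv : graftFlag S' ρ h q near T' v
    · exact absurd huv.symm (graft_root_ne hG hT hfv hfu)
    · rw [graft_root_of_not_flag hfu, graft_root_of_not_flag hfv] at huv
      exact absurd ⟨mem_of_not_graftFlag hfu, mem_of_not_graftFlag hfv, huv⟩ hs

lemma graft_lo_le_hi_par (hG : GeodesicSplit S S' ρ pos n q idx near)
    (hT : T'.Spans S' ρ (fun x => min (h x) (ρ x (q (near x)))) m)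
    (hL : ∀ x ∈ S', T'.hi x + 2 ≤ L) {x : V} (hx : x ∈ S) :
    (graft S' ρ h pos q idx near T' L cut).lo x
      ≤ (graft S' ρ h pos q idx near T' L cut).hi
        ((graft S' ρ h pos q idx near T' L cut).par x) ∧
    (graft S' ρ h pos q idx near T' L cut).lo ((graft S' ρ h pos q idx near T' L cut).par x)
      ≤ (graft S' ρ h pos q idx near T' L cut).hi x := by
  rcases graft_par_cases (T' := T') (h := h) (L := L) (cut := cut) hG hx with
    ⟨h1, h2⟩ | ⟨j, hj, -, rfl, h2⟩ | ⟨h1, -, -, h2⟩ | ⟨h1, hr, -, h2⟩ | ⟨h1, hr, h2⟩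
  · rw [h2]
    simp only [graft, h1, if_false]
    constructor <;> nlinarith
  · rw [h2]
    simp only [graft, hG.q_notMem, if_false, hG.idx_q _ hj, hG.idx_q j (by lia)]
    constructor <;> nlinarith
  · rw [h2]
    simp only [graft, h1, if_true]
    have := hT.lo_le_hi x h1
    constructor <;> lia
  · rw [h2]
    simp only [graft, h1, if_true, hG.q_notMem, if_false, hG.idx_q _ (hG.near_le x), hr]
    have h3 := hT.lo_le_hi x h1
    have h4 := hL x h1
    constructor <;> nlinarith
  · rw [h2]
    simp only [graft, h1, if_true, hT.par_mem x h1, hT.root_par x h1]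
    have := hT.lo_le_hi_par x h1
    constructor <;> lia

lemma graft_card_le (hG : GeodesicSplit S S' ρ pos n q idx near)
    (hT : T'.Spans S' ρ (fun x => min (h x) (ρ x (q (near x)))) m) (hm : 1 ≤ m)
    (hL0 : 1 ≤ L) (hL : ∀ x ∈ S', T'.hi x + 2 ≤ L) (t : ℕ) :
    (S.filter fun x => (graft S' ρ h pos q idx near T' L cut).lo x ≤ t ∧
      t ≤ (graft S' ρ h pos q idx near T' L cut).hi x).card ≤ m + 1 := by
  classical
  obtain ⟨i, r, hr, rfl⟩ : ∃ i r, r < L ∧ t = i * L + r :=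
    ⟨t / L, t % L, Nat.mod_lt _ hL0, by rw [mul_comm]; exact (Nat.div_add_mod t L).symm⟩
  have hblock : ∀ {j s : ℕ}, s < L → j * L + s = i * L + r → j = i ∧ s = r := by
    intro j s hs he
    have h1 := congrArg (· / L) he
    have h2 := congrArg (· % L) he
    simp only [mul_comm _ L, Nat.mul_add_div hL0, Nat.mul_add_mod, Nat.div_eq_of_lt hs,
      Nat.div_eq_of_lt hr, Nat.mod_eq_of_lt hs, Nat.mod_eq_of_lt hr, add_zero] at h1 h2
    exact ⟨h1, h2⟩
  have hmem : ∀ x ∈ S', (graft S' ρ h pos q idx near T' L cut).lo x ≤ i * L + r →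
      i * L + r ≤ (graft S' ρ h pos q idx near T' L cut).hi x →
      1 ≤ r ∧ T'.lo x ≤ r - 1 ∧ r - 1 ≤ T'.hi x := by
    intro x hx h1 h2
    simp only [graft, hx, if_true] at h1 h2
    have h3 := hL x hx
    obtain ⟨s, hs⟩ := Nat.exists_eq_add_of_le h1
    obtain ⟨h4, h5⟩ := hblock (j := near (T'.root x)) (s := 1 + T'.lo x + s) (by lia) (by lia)
    lia
  have hout : ∀ x ∈ S, x ∉ S' → (graft S' ρ h pos q idx near T' L cut).lo x ≤ i * L + r →
      i * L + r ≤ (graft S' ρ h pos q idx near T' L cut).hi x →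
      x = q i ∨ (r = 0 ∧ x = q (i - 1)) := by
    intro x hx hx' h1 h2
    simp only [graft, hx', if_false] at h1 h2
    rw [← hG.q_idx x hx hx']
    rcases Nat.lt_trichotomy (idx x) i with hlt | heq | hgt
    · have h3 : (idx x + 1) * L ≤ i * L := Nat.mul_le_mul_right L hlt
      have h4 : idx x + 1 = i := Nat.eq_of_mul_eq_mul_right hL0 (by lia)
      exact Or.inr ⟨by lia, by rw [← h4, Nat.add_sub_cancel]⟩
    · exact Or.inl (by rw [heq])
    · have h3 : (i + 1) * L ≤ idx x * L := Nat.mul_le_mul_right L hgt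
      rw [Nat.add_mul] at h3
      lia
  rcases Nat.eq_zero_or_pos r with hr0 | hr0
  · refine (Finset.card_le_card (t := {q i, q (i - 1)}) fun x hx => ?_).trans
      (Finset.card_le_two.trans (by lia))
    obtain ⟨hxS, h1, h2⟩ := Finset.mem_filter.1 hx
    by_cases hx' : x ∈ S'
    · exact absurd (hmem x hx' h1 h2).1 (by lia)
    · rcases hout x hxS hx' h1 h2 with h3 | ⟨-, h3⟩ <;> simp [h3]
  · refine (Finset.card_le_card (t := insert (q i)
      (S'.filter fun x => T'.lo x ≤ r - 1 ∧ r - 1 ≤ T'.hi x)) fun x hx => ?_).trans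
      ((Finset.card_insert_le _ _).trans (Nat.add_le_add_right (hT.card_le _) 1))
    obtain ⟨hxS, h1, h2⟩ := Finset.mem_filter.1 hx
    by_cases hx' : x ∈ S'
    · exact Finset.mem_insert_of_mem (Finset.mem_filter.2 ⟨hx', (hmem x hx' h1 h2).2⟩)
    · rcases hout x hxS hx' h1 h2 with h3 | ⟨h3, -⟩
      · exact h3 ▸ Finset.mem_insert_self _ _
      · lia

lemma graft_root_mem (hG : GeodesicSplit S S' ρ pos n q idx near)
    (hT : T'.Spans S' ρ (fun x => min (h x) (ρ x (q (near x)))) m) (x : V) :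
    (graft S' ρ h pos q idx near T' L cut).root x ∈ S := by
  by_cases hf : graftFlag S' ρ h q near T' x
  · rw [graft_root_of_flag hf]
    exact hG.q_mem _
  · rw [graft_root_of_not_flag hf]
    exact hG.subset (hT.root_mem x (mem_of_not_graftFlag hf))

lemma graft_par_root (hG : GeodesicSplit S S' ρ pos n q idx near)
    (hT : T'.Spans S' ρ (fun x => min (h x) (ρ x (q (near x)))) m) {x : V} (hx : x ∈ S) :
    (graft S' ρ h pos q idx near T' L cut).par ((graft S' ρ h pos q idx near T' L cut).root x)
      = (graft S' ρ h pos q idx near T' L cut).root x := by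
  by_cases hf : graftFlag S' ρ h q near T' x
  · have hB := (segRoot_le (cut := cut) _).trans (graftBase_le (T' := T') hG hx)
    rw [graft_root_of_flag hf]
    simp [graft, hG.q_notMem, hG.idx_q _ hB, segRoot_segRoot]
  · have hx' := mem_of_not_graftFlag hf
    have h2 : ¬ ρ (T'.root x) (q (near (T'.root x))) < h (T'.root x) := fun h2 => hf fun _ => h2
    rw [graft_root_of_not_flag hf]
    simp [graft, hT.root_mem x hx', hT.root_root x hx', h2]

lemma graft_root_root (hG : GeodesicSplit S S' ρ pos n q idx near)
    (hT : T'.Spans S' ρ (fun x => min (h x) (ρ x (q (near x)))) m) {x : V} (hx : x ∈ S) :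
    (graft S' ρ h pos q idx near T' L cut).root ((graft S' ρ h pos q idx near T' L cut).root x)
      = (graft S' ρ h pos q idx near T' L cut).root x := by
  by_cases hf : graftFlag S' ρ h q near T' x
  · have hB := (segRoot_le (cut := cut) _).trans (graftBase_le (T' := T') hG hx)
    rw [graft_root_of_flag hf, graft_root_q hG hB, segRoot_segRoot]
  · have hx' := mem_of_not_graftFlag hf
    rw [graft_root_of_not_flag hf,
      graft_root_eq_of_mem (hT.root_mem x hx') hx' (hT.root_root x hx'),
      graft_root_of_not_flag hf]

lemma graft_root_par (hG : GeodesicSplit S S' ρ pos n q idx near)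
    (hT : T'.Spans S' ρ (fun x => min (h x) (ρ x (q (near x)))) m) {x : V} (hx : x ∈ S) :
    (graft S' ρ h pos q idx near T' L cut).root ((graft S' ρ h pos q idx near T' L cut).par x)
      = (graft S' ρ h pos q idx near T' L cut).root x := by
  rcases graft_par_cases (T' := T') (h := h) (L := L) (cut := cut) hG hx with
    ⟨h1, h2⟩ | ⟨j, hj, hcut, rfl, h2⟩ | ⟨h1, -, -, h2⟩ | ⟨h1, hr, ha, h2⟩ | ⟨h1, hr, h2⟩
  · rw [h2]
  · rw [h2, graft_root_q hG hj, graft_root_q hG (by lia), segRoot_succ_of_not_cut hcut]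
  · rw [h2]
  · have hf : graftFlag S' ρ h q near T' x := fun _ => by rwa [hr]
    rw [h2, graft_root_q hG (hG.near_le x), graft_root_of_flag hf, graftBase, if_pos h1, hr]
  · rw [h2]
    exact graft_root_eq_of_mem (hT.par_mem x h1) h1 (hT.root_par x h1)

lemma graft_par_mem (hG : GeodesicSplit S S' ρ pos n q idx near)
    (hT : T'.Spans S' ρ (fun x => min (h x) (ρ x (q (near x)))) m) {x : V} (hx : x ∈ S) :
    (graft S' ρ h pos q idx near T' L cut).par x ∈ S := by
  rcases graft_par_cases (T' := T') (h := h) (L := L) (cut := cut) hG hx with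
    ⟨h1, h2⟩ | ⟨j, hj, hcut, rfl, h2⟩ | ⟨h1, -, -, h2⟩ | ⟨h1, hr, ha, h2⟩ | ⟨h1, hr, h2⟩
  · rwa [h2]
  · rw [h2]
    exact hG.q_mem _
  · rwa [h2]
  · rw [h2]
    exact hG.q_mem _
  · rw [h2]
    exact hG.subset (hT.par_mem x h1)

theorem graft_spans (hG : GeodesicSplit S S' ρ pos n q idx near)
    (hT : T'.Spans S' ρ (fun x => min (h x) (ρ x (q (near x)))) m) (hm : 1 ≤ m)
    (hδρ : ∀ x y, δ x y ≤ ρ x y) (hL0 : 1 ≤ L) (hL : ∀ x ∈ S', T'.hi x + 2 ≤ L) :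
    (graft S' ρ h pos q idx near T' L cut).Spans S δ h (m + 1) where
  par_mem _ hx := graft_par_mem hG hT hx
  root_mem x _ := graft_root_mem hG hT x
  par_root _ hx := graft_par_root hG hT hx
  root_root _ hx := graft_root_root hG hT hx
  root_par _ hx := graft_root_par hG hT hx
  cost_ge _ hc hcp _ hx :=
    graft_cost_ge hG hT hc (fun y hy => (hcp y hy).trans (hδρ _ _)) hx
  dist_ge _ hc hcp _ hu _ hv huv :=
    graft_dist_ge hG hT hc (fun y hy => (hcp y hy).trans (hδρ _ _)) hu hv huv
  lo_le_hi x _ := by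
    by_cases hx' : x ∈ S'
    · have := hT.lo_le_hi x hx'
      simp only [graft, hx', if_true]
      lia
    · simp only [graft, hx', if_false]
      exact Nat.mul_le_mul_right L (Nat.le_succ _)
  lo_le_hi_par _ hx := graft_lo_le_hi_par hG hT hL hx
  card_le := graft_card_le hG hT hm hL0 hL

lemma graft_cost_le (hG : GeodesicSplit S S' ρ pos n q idx near)
    (hT : T'.Spans S' ρ (fun x => min (h x) (ρ x (q (near x)))) m) (h0 : ∀ x, 0 ≤ h x)
    (hh : ∀ x y, |h x - h y| ≤ ρ x y)
    (hcut : ∀ i ≤ n, segCost cut (fun i => pos (q i)) (fun i => h (q i)) i ≤ 3 * h (q i))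
    {x : V} (hx : x ∈ S) :
    (graft S' ρ h pos q idx near T' L cut).cost x ≤ 4 * graftExtra S' T' x + 3 * h x := by
  have he := graftExtra_nonneg hG hT h0 x
  by_cases hf : graftFlag S' ρ h q near T' x
  · have h1 := hcut _ (graftBase_le (T' := T') hG hx)
    have h2 := rho_graft_base_le hG hT hx hf
    have h3 := (abs_le.1 (hh x (q (graftBase S' idx near T' x)))).1
    simp only [graft]
    rw [if_pos hf]
    linarith
  · simp only [graft]
    rw [if_neg hf]
    linarith [h0 x]

lemma graft_length_of_flag (hG : GeodesicSplit S S' ρ pos n q idx near) {u v : V} (hu : u ∈ S)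
    (hv : v ∈ S) (huv : ¬ (u ∈ S' ∧ v ∈ S' ∧ T'.root u = T'.root v))
    (hfu : graftFlag S' ρ h q near T' u) (hfv : graftFlag S' ρ h q near T' v) :
    (graft S' ρ h pos q idx near T' L cut).length u v = graftExtra S' T' u + graftExtra S' T' v
      + segDist cut (fun i => pos (q i)) (fun i => h (q i)) (graftBase S' idx near T' u)
        (graftBase S' idx near T' v) := by
  rw [ApexTree.length, graft_root_of_flag hfu, graft_root_of_flag hfv, segDist]
  have hBu := graftBase_le (T' := T') hG hu
  have hBv := graftBase_le (T' := T') hG hv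
  by_cases hr : segRoot cut (graftBase S' idx near T' u)
      = segRoot cut (graftBase S' idx near T' v)
  · rw [if_pos hr, if_pos (by rw [hr])]
    simp only [graft]
    rw [if_neg huv]
  · rw [if_neg hr, if_neg fun he => hr
      (q_inj hG ((segRoot_le _).trans hBu) ((segRoot_le _).trans hBv) he)]
    simp only [graft]
    rw [if_pos hfu, if_pos hfv]
    ring

lemma graft_length_of_flag_of_not_flag (hG : GeodesicSplit S S' ρ pos n q idx near)
    (hT : T'.Spans S' ρ (fun x => min (h x) (ρ x (q (near x)))) m)
    (hh : ∀ x y, |h x - h y| ≤ ρ x y)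
    (hcut : ∀ i ≤ n, segCost cut (fun i => pos (q i)) (fun i => h (q i)) i ≤ 3 * h (q i))
    {u v : V} (hu : u ∈ S) (hfu : graftFlag S' ρ h q near T' u)
    (hfv : ¬ graftFlag S' ρ h q near T' v) :
    (graft S' ρ h pos q idx near T' L cut).cost u + (graft S' ρ h pos q idx near T' L cut).cost v
      ≤ 4 * (graftExtra S' T' u + graftExtra S' T' v) + 3 * ρ u v := by
  have h1 := hcut _ (graftBase_le (T' := T') hG hu)
  have h2 := rho_graft_base_le hG hT hu hfu
  have h3 := (abs_le.1 (hh v (q (graftBase S' idx near T' u)))).1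
  have h4 := hG.pseudometric.triangle v u (q (graftBase S' idx near T' u))
  have h5 := (le_graftExtra_of_not_flag hG hT hh hfv).2
  rw [hG.pseudometric.symm v u] at h4
  simp only [graft]
  rw [if_pos hfu, if_neg hfv]
  linarith

open Classical in
/-- A bound, up to constants, for the expected distance in a randomly cut graft. -/
noncomputable def graftBound (S' : Finset V) (T' : ApexTree V) (u v : V) : ℝ :=
  if u ∈ S' ∧ v ∈ S' then T'.length u v else graftExtra S' T' u + graftExtra S' T' v

lemma graft_length_of_mem {u v : V} (hu : u ∈ S') (hv : v ∈ S') (huv : T'.root u = T'.root v) :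
    (graft S' ρ h pos q idx near T' L cut).length u v = T'.dist u v := by
  rw [ApexTree.length, if_pos (graft_root_eq_of_mem hu hv huv)]
  simp only [graft]
  rw [if_pos ⟨hu, hv, huv⟩]

lemma graftBound_of_not {u v : V} (huv : ¬ (u ∈ S' ∧ v ∈ S' ∧ T'.root u = T'.root v)) :
    graftBound S' T' u v = graftExtra S' T' u + graftExtra S' T' v := by
  rw [graftBound]
  split_ifs with h1
  · rw [ApexTree.length, if_neg fun h2 => huv ⟨h1.1, h1.2, h2⟩, graftExtra, graftExtra, if_pos h1.1,
      if_pos h1.2]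
  · rfl

theorem sum_graft_length_le (hG : GeodesicSplit S S' ρ pos n q idx near)
    (hT : T'.Spans S' ρ (fun x => min (h x) (ρ x (q (near x)))) m) (h0 : ∀ x, 0 ≤ h x)
    (hh : ∀ x y, |h x - h y| ≤ ρ x y) {N : ℕ} {cut : Fin N → ℕ → Prop}
    (hcut : ∀ ω, ∀ i ≤ n,
      segCost (cut ω) (fun i => pos (q i)) (fun i => h (q i)) i ≤ 3 * h (q i))
    (hdist : ∀ i ≤ n, ∀ j ≤ n, ∑ ω, segDist (cut ω) (fun i => pos (q i)) (fun i => h (q i)) i j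
      ≤ N * (50 * |pos (q i) - pos (q j)|)) {u v : V} (hu : u ∈ S) (hv : v ∈ S) :
    ∑ ω, (graft S' ρ h pos q idx near T' L (cut ω)).length u v
      ≤ N * (51 * graftBound S' T' u v + 50 * ρ u v) := by
  have hρ := hG.pseudometric.nonneg u v
  have hN : (0 : ℝ) ≤ N := N.cast_nonneg
  by_cases huv : u ∈ S' ∧ v ∈ S' ∧ T'.root u = T'.root v
  · simp only [graft_length_of_mem huv.1 huv.2.1 huv.2.2]
    rw [graftBound, if_pos ⟨huv.1, huv.2.1⟩, ApexTree.length, if_pos huv.2.2, Finset.sum_const,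
      Finset.card_univ, Fintype.card_fin, nsmul_eq_mul]
    have := hT.dist_nonneg hG.pseudometric huv.1 huv.2.1 huv.2.2
    exact mul_le_mul_of_nonneg_left (by linarith) hN
  rw [graftBound_of_not huv]
  have heu := graftExtra_nonneg hG hT h0 u
  have hev := graftExtra_nonneg hG hT h0 v
  by_cases hfuv : graftFlag S' ρ h q near T' u ∧ graftFlag S' ρ h q near T' v
  · obtain ⟨hfu, hfv⟩ := hfuv
    simp only [graft_length_of_flag hG hu hv huv hfu hfv]
    rw [Finset.sum_add_distrib, Finset.sum_const, Finset.card_univ, Fintype.card_fin,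
      nsmul_eq_mul]
    refine (add_le_add_right (hdist _ (graftBase_le hG hu) _ (graftBase_le hG hv)) _).trans ?_
    rw [← mul_add]
    refine mul_le_mul_of_nonneg_left ?_ hN
    have h1 := rho_graft_base_le hG hT hu hfu
    have h2 := rho_graft_base_le hG hT hv hfv
    rw [hG.pseudometric.symm] at h1
    rw [← hG.rho_q]
    linarith [hG.pseudometric.triangle (q (graftBase S' idx near T' u)) u
        (q (graftBase S' idx near T' v)),
      hG.pseudometric.triangle u v (q (graftBase S' idx near T' v))]
  · refine (Finset.sum_le_card_nsmul _ _
      (51 * (graftExtra S' T' u + graftExtra S' T' v) + 50 * ρ u v) fun ω _ => ?_).trans_eq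
      (by rw [Finset.card_univ, Fintype.card_fin, nsmul_eq_mul])
    by_cases hfu : graftFlag S' ρ h q near T' u
    · have hfv : ¬ graftFlag S' ρ h q near T' v := fun hfv => hfuv ⟨hfu, hfv⟩
      rw [ApexTree.length, if_neg (graft_root_ne hG hT hfu hfv)]
      linarith [graft_length_of_flag_of_not_flag (L := L) hG hT hh (hcut ω) hu hfu hfv]
    by_cases hfv : graftFlag S' ρ h q near T' v
    · rw [ApexTree.length, if_neg (graft_root_ne hG hT hfv hfu).symm]
      have := graft_length_of_flag_of_not_flag (L := L) hG hT hh (hcut ω) hv hfv hfu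
      rw [hG.pseudometric.symm v u] at this
      linarith
    · have hr : ¬ T'.root u = T'.root v := fun hr =>
        huv ⟨mem_of_not_graftFlag hfu, mem_of_not_graftFlag hfv, hr⟩
      rw [ApexTree.length, graft_root_of_not_flag hfu, graft_root_of_not_flag hfv, if_neg hr]
      simp only [graft]
      rw [if_neg hfu, if_neg hfv]
      linarith

end Graft

/-- There is a random forest on `S` of pathwidth less than `m` such that, after joining the roots
to an apex at cost `h`, intersecting pairs of intervals are at expected distance at most `D` times
their `δ`-distance, and the expected distance to the apex is at most `D * h`. -/
def HasRandomApexTree (S : Finset V) (δ : V → V → ℝ) (h : V → ℝ) (α β : V → ℕ) (m : ℕ) (D : ℝ) :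
    Prop :=
  ∃ (Ω : Type) (_ : Fintype Ω) (p : Ω → ℝ) (T : Ω → ApexTree V), (∀ ω, 0 ≤ p ω) ∧
    ∑ ω, p ω = 1 ∧ (∀ ω, (T ω).Spans S δ h m) ∧
    (∀ u ∈ S, ∀ v ∈ S, α u ≤ β v → α v ≤ β u → ∑ ω, p ω * (T ω).length u v ≤ D * δ u v) ∧
    ∀ x ∈ S, ∑ ω, p ω * (T ω).cost x ≤ D * h x

lemma hasRandomApexTree_one {S : Finset V} {δ : V → V → ℝ} {h : V → ℝ} {α β : V → ℕ}
    (hδ : IsPseudometric δ) (hαβ : ∀ x ∈ S, α x ≤ β x)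
    (hS : ∀ t, (S.filter fun x => α x ≤ t ∧ t ≤ β x).card ≤ 1) :
    HasRandomApexTree S δ h α β 1 1 := by
  refine ⟨Unit, inferInstance, fun _ => 1, fun _ => ⟨id, id, h, fun _ _ => 0, α, β⟩,
    fun _ => zero_le_one, by simp, fun _ => ?_, fun u hu v hv h1 h2 => ?_, by simp⟩
  · exact
      { par_mem := fun _ hx => hx
        root_mem := fun _ hx => hx
        par_root := fun _ _ => rfl
        root_root := fun _ _ => rfl
        root_par := fun _ _ => rfl
        cost_ge := fun c hc _ x _ => by simp [hc.self]
        dist_ge := fun c hc _ u _ v _ huv => by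
          obtain rfl : u = v := huv
          simp [hc.self]
        lo_le_hi := hαβ
        lo_le_hi_par := fun x hx => ⟨hαβ x hx, hαβ x hx⟩
        card_le := hS }
  · have hau := hαβ u hu
    have hav := hαβ v hv
    have huv : u = v := Finset.card_le_one.1 (hS (max (α u) (α v))) u
      (Finset.mem_filter.2 ⟨hu, by lia⟩) v (Finset.mem_filter.2 ⟨hv, by lia⟩)
    simp [ApexTree.length, huv, hδ.self]

lemma hasRandomApexTree_graft {S S' : Finset V} {δ ρ : V → V → ℝ} {h pos : V → ℝ} {q : ℕ → V}
    {idx near α β : V → ℕ} {n m : ℕ} {D : ℝ} (hG : GeodesicSplit S S' ρ pos n q idx near)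
    (hm : 1 ≤ m) (hD : 0 ≤ D) (hδρ : ∀ x y, δ x y ≤ ρ x y)
    (hρδ : ∀ u ∈ S, ∀ v ∈ S, α u ≤ β v → α v ≤ β u → ρ u v ≤ δ u v) (h0 : ∀ x, 0 ≤ h x)
    (hh : ∀ x y, |h x - h y| ≤ ρ x y)
    (hT : HasRandomApexTree S' ρ (fun x => min (h x) (ρ x (q (near x)))) α β m D) :
    HasRandomApexTree S δ h α β (m + 1) (51 * D + 50) := by
  obtain ⟨Ω, _, p, T, hp, hp1, hT, hlen, hcost⟩ := hT
  obtain ⟨N, cut, hN, hcut, hdist⟩ := exists_random_cut (p := fun i => pos (q i))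
    (h := fun i => h (q i)) hG.mono (fun i => h0 _)
    (fun i j => by rw [← hG.rho_q]; exact hh _ _) n
  have hN' : (0 : ℝ) < N := by exact_mod_cast hN
  have hmean : ∀ (f : Ω → ℝ) (a b : ℝ), ∑ ω, p ω * (a * f ω + b) = a * ∑ ω, p ω * f ω + b := by
    intro f a b
    simp only [mul_add, Finset.sum_add_distrib, ← Finset.sum_mul, hp1, one_mul, mul_left_comm _ a,
      ← Finset.mul_sum]
  have hextra : ∀ x ∈ S, ∑ ω, p ω * graftExtra S' (T ω) x ≤ D * h x ∧
      ∀ y ∈ S, y ∉ S' → ∑ ω, p ω * graftExtra S' (T ω) x ≤ D * ρ x y := by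
    intro x hx
    by_cases hx' : x ∈ S'
    · simp only [graftExtra, hx', if_true]
      have h1 := hcost x hx'
      refine ⟨h1.trans (mul_le_mul_of_nonneg_left (min_le_left _ _) hD), fun y hy hy' =>
        h1.trans (mul_le_mul_of_nonneg_left ((min_le_right _ _).trans ?_) hD)⟩
      have h2 := hG.rho_near_le x _ (hG.idx_le y hy hy')
      rwa [hG.q_idx y hy hy'] at h2
    · simp only [graftExtra, hx', if_false, mul_zero, Finset.sum_const_zero]
      exact ⟨mul_nonneg hD (h0 x), fun y _ _ => mul_nonneg hD (hG.pseudometric.nonneg _ _)⟩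
  refine ⟨Fin N × Ω, inferInstance, fun ω => p ω.2 / N, fun ω =>
    graft S' ρ h pos q idx near (T ω.2) (S'.sup (T ω.2).hi + 2) (cut ω.1),
    fun ω => div_nonneg (hp _) hN'.le, ?_, fun ω => ?_, fun u hu v hv h1 h2 => ?_,
    fun x hx => ?_⟩
  · simp only [Fintype.sum_prod_type, ← Finset.sum_div, hp1, Finset.sum_const, Finset.card_univ,
      Fintype.card_fin, nsmul_eq_mul, mul_one,
      div_self hN'.ne']
  · exact graft_spans hG (hT _) hm hδρ (by lia)
      fun x hx => Nat.add_le_add_right (Finset.le_sup hx) 2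
  · rw [Fintype.sum_prod_type_right]
    have hX : ∑ ω, p ω * graftBound S' (T ω) u v ≤ D * ρ u v := by
      have hexp : ∑ ω, p ω * (graftExtra S' (T ω) u + graftExtra S' (T ω) v)
          = ∑ ω, p ω * graftExtra S' (T ω) u + ∑ ω, p ω * graftExtra S' (T ω) v := by
        simp only [mul_add, Finset.sum_add_distrib]
      by_cases hu' : u ∈ S'
      · by_cases hv' : v ∈ S'
        · simpa only [graftBound, hu', hv', and_self, if_true] using hlen u hu' v hv' h1 h2
        · simp only [graftBound, hu', hv', and_false, if_false]
          rw [hexp]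
          simpa [graftExtra, hv'] using (hextra u hu).2 v hv hv'
      · simp only [graftBound, hu', false_and, if_false]
        rw [hexp, hG.pseudometric.symm]
        simpa [graftExtra, hu'] using (hextra v hv).2 u hu hu'
    calc ∑ ω, ∑ a, p ω / N * (graft S' ρ h pos q idx near (T ω) (S'.sup (T ω).hi + 2)
          (cut a)).length u v
        ≤ ∑ ω, p ω * (51 * graftBound S' (T ω) u v + 50 * ρ u v) := by
          refine Finset.sum_le_sum fun ω _ => ?_
          rw [← Finset.mul_sum]
          refine (mul_le_mul_of_nonneg_left (sum_graft_length_le hG (hT ω) h0 hh hcut hdist hu hv)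
            (div_nonneg (hp ω) hN'.le)).trans_eq ?_
          field_simp
      _ = 51 * ∑ ω, p ω * graftBound S' (T ω) u v + 50 * ρ u v := hmean _ _ _
      _ ≤ (51 * D + 50) * ρ u v := by linarith
      _ ≤ (51 * D + 50) * δ u v :=
          mul_le_mul_of_nonneg_left (hρδ u hu v hv h1 h2) (by linarith)
  · rw [Fintype.sum_prod_type_right]
    calc ∑ ω, ∑ a, p ω / N * (graft S' ρ h pos q idx near (T ω) (S'.sup (T ω).hi + 2)
          (cut a)).cost x
        ≤ ∑ ω, p ω * (4 * graftExtra S' (T ω) x + 3 * h x) := by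
          refine Finset.sum_le_sum fun ω _ => ?_
          refine (Finset.sum_le_card_nsmul _ _ (p ω / N * (4 * graftExtra S' (T ω) x + 3 * h x))
            fun a _ => mul_le_mul_of_nonneg_left (graft_cost_le hG (hT ω) h0 hh (hcut a) hx)
              (div_nonneg (hp ω) hN'.le)).trans_eq ?_
          rw [Finset.card_univ, Fintype.card_fin, nsmul_eq_mul]
          field_simp
      _ = 4 * ∑ ω, p ω * graftExtra S' (T ω) x + 3 * h x := hmean _ _ _
      _ ≤ (51 * D + 50) * h x := by
          have := mul_nonneg hD (h0 x)
          linarith [(hextra x hx).1, h0 x]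

/-- The geodesic separator of an interval system together with the induced splitting. -/
lemma exists_geodesicSplit [Finite V] {S : Finset V} {δ : V → V → ℝ} {α β : V → ℕ} {m : ℕ}
    (hδ : IsPseudometric δ) (hne : S.Nonempty) (hαβ : ∀ x ∈ S, α x ≤ β x)
    (hS : ∀ t, (S.filter fun x => α x ≤ t ∧ t ≤ β x).card ≤ m + 1) :
    ∃ (S' : Finset V) (ρ : V → V → ℝ) (pos : V → ℝ) (n : ℕ) (q : ℕ → V) (idx near : V → ℕ),
      GeodesicSplit S S' ρ pos n q idx near ∧ (∀ x y, δ x y ≤ ρ x y) ∧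
      (∀ u ∈ S, ∀ v ∈ S, α u ≤ β v → α v ≤ β u → ρ u v ≤ δ u v) ∧
      ∀ t, (S'.filter fun x => α x ≤ t ∧ t ≤ β x).card ≤ m := by
  classical
  obtain ⟨n, q, pos, hqS, hinj, hmono, hpos, hgeo, hstab, hhit⟩ :=
    exists_geodesic_separator hδ hne hαβ
  have hρ := hδ.max_abs_sub pos
  set ρ : V → V → ℝ := fun x y => max (δ x y) |pos x - pos y| with hρdef
  set S' := S.filter fun x => ∀ i ≤ n, q i ≠ x with hS'
  have hnot : ∀ i ≤ n, q i ∉ S' := fun i hi hm => (Finset.mem_filter.1 hm).2 i hi rfl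
  have hidx : ∀ x, ∃ j, x ∈ S → x ∉ S' → j ≤ n ∧ q j = x := by
    intro x
    by_cases hx : x ∈ S ∧ x ∉ S'
    · have h1 := hx.2
      rw [hS', Finset.mem_filter] at h1
      push Not at h1
      obtain ⟨j, hj, hq⟩ := h1 hx.1
      exact ⟨j, fun _ _ => ⟨hj, hq⟩⟩
    · exact ⟨0, fun h1 h2 => absurd ⟨h1, h2⟩ hx⟩
  choose idx hidx using hidx
  have hnear : ∀ x, ∃ j ≤ n, ∀ i ≤ n, ρ x (q j) ≤ ρ x (q i) := by
    intro x
    obtain ⟨j, hj, hmin⟩ := Finset.exists_min_image (Finset.range (n + 1)) (fun i => ρ x (q i))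
      ⟨0, by simp⟩
    exact ⟨j, by simpa [Nat.lt_succ_iff] using hj,
      fun i hi => hmin i (by simpa [Nat.lt_succ_iff] using hi)⟩
  choose near hnear_le hnear using hnear
  refine ⟨S', ρ, pos, n, q, idx, near, ⟨hρ, Finset.filter_subset _ _, hqS, fun i => ?_,
    fun x hx hx' => (hidx x hx hx').1, fun x hx hx' => (hidx x hx hx').2, fun i hi => ?_,
    hnear_le, hnear, hmono, fun i j => max_eq_right (hgeo i j)⟩, fun x y => le_max_left _ _,
    fun u hu v hv h1 h2 => max_le le_rfl (hpos u hu v hv h1 h2), fun t => ?_⟩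
  · rcases le_total i n with hi | hi
    · exact hnot i hi
    · rw [hstab i hi]
      exact hnot n le_rfl
  · have h1 := hidx (q i) (hqS i) (hnot i hi)
    exact hinj h1.1 hi h1.2
  · by_cases ht : ∃ x ∈ S, α x ≤ t ∧ t ≤ β x
    · obtain ⟨x, hx, hxt⟩ := ht
      obtain ⟨i, hi, hit⟩ := hhit t x hx hxt.1 hxt.2
      refine Nat.le_of_lt_succ (lt_of_lt_of_le (Finset.card_lt_card ?_) (hS t))
      rw [Finset.ssubset_iff_of_subset (Finset.filter_subset_filter _ (Finset.filter_subset _ _))]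
      exact ⟨q i, Finset.mem_filter.2 ⟨hqS i, hit⟩,
        fun hm => hnot i hi (Finset.mem_filter.1 hm).1⟩
    · push Not at ht
      rw [Finset.filter_eq_empty_iff.2 fun x hx hxt =>
        absurd hxt.2 (not_le.2 (ht x (Finset.mem_filter.1 hx).1 hxt.1)), Finset.card_empty]
      exact Nat.zero_le _

lemma GeodesicSplit.abs_min_sub_min_le {S S' : Finset V} {ρ : V → V → ℝ} {h pos : V → ℝ}
    {q : ℕ → V} {idx near : V → ℕ} {n : ℕ} (hG : GeodesicSplit S S' ρ pos n q idx near)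
    (hh : ∀ x y, |h x - h y| ≤ ρ x y) (x y : V) :
    |min (h x) (ρ x (q (near x))) - min (h y) (ρ y (q (near y)))| ≤ ρ x y := by
  refine (abs_min_sub_min_le_max _ _ _ _).trans (max_le (hh x y) (abs_le.2 ⟨?_, ?_⟩))
  · linarith [hG.rho_near_le y _ (hG.near_le x), hG.pseudometric.triangle y x (q (near x)),
      hG.pseudometric.symm x y]
  · linarith [hG.rho_near_le x _ (hG.near_le y), hG.pseudometric.triangle x y (q (near y))]

theorem exists_hasRandomApexTree {m : ℕ} (hm : 1 ≤ m) : ∃ D : ℝ, 0 ≤ D ∧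
    ∀ (V : Type) [Finite V] (S : Finset V) (δ : V → V → ℝ) (h : V → ℝ) (α β : V → ℕ),
      IsPseudometric δ → (∀ x, 0 ≤ h x) → (∀ x y, |h x - h y| ≤ δ x y) →
      (∀ x ∈ S, α x ≤ β x) → (∀ t, (S.filter fun x => α x ≤ t ∧ t ≤ β x).card ≤ m) →
      HasRandomApexTree S δ h α β m D := by
  induction m, hm using Nat.le_induction with
  | base =>
    exact ⟨1, zero_le_one, fun V _ S δ h α β hδ _ _ hαβ hS => hasRandomApexTree_one hδ hαβ hS⟩
  | succ m hm ih =>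
    obtain ⟨D, hD, ih⟩ := ih
    refine ⟨51 * D + 50, by linarith, fun V _ S δ h α β hδ h0 hh hαβ hS => ?_⟩
    rcases S.eq_empty_or_nonempty with rfl | hne
    · exact ⟨Unit, inferInstance, fun _ => 1, fun _ => ⟨id, id, h, fun _ _ => 0, α, β⟩,
        fun _ => zero_le_one, by simp, fun _ => by constructor <;> simp, by simp, by simp⟩
    obtain ⟨S', ρ, pos, n, q, idx, near, hG, hδρ, hρδ, hS'⟩ :=
      exists_geodesicSplit hδ hne hαβ hS
    have hhρ : ∀ x y, |h x - h y| ≤ ρ x y := fun x y => (hh x y).trans (hδρ x y)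
    exact hasRandomApexTree_graft hG hm hD hδρ hρδ h0 hhρ (ih V S' ρ _ α β hG.pseudometric
      (fun x => le_min (h0 x) (hG.pseudometric.nonneg _ _)) (hG.abs_min_sub_min_le hhρ)
      (fun x hx => hαβ x (hG.subset hx)) hS')

end ApexTree

namespace ApexTree

section ToGraph

variable {V : Type} {T : ApexTree V} {δ : V → V → ℝ} {h : V → ℝ} {m : ℕ}

/-- The graph joining every vertex to its parent. -/
def toGraph (T : ApexTree V) : SimpleGraph V := SimpleGraph.fromRel fun x y => T.par x = y

lemma toGraph_adj (T : ApexTree V) {x y : V} :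
    T.toGraph.Adj x y ↔ x ≠ y ∧ (T.par x = y ∨ T.par y = x) :=
  SimpleGraph.fromRel_adj _ _ _

lemma toGraph_reachable_par (T : ApexTree V) (x : V) : T.toGraph.Reachable x (T.par x) := by
  by_cases hx : x = T.par x
  · rw [← hx]
  · exact SimpleGraph.Adj.reachable (T.toGraph_adj.2 ⟨hx, Or.inl rfl⟩)

variable [Fintype V]

lemma Spans.reachable_root (hT : T.Spans Finset.univ δ h m) (hδ : IsPseudometric δ)
    (h0 : ∀ x, 0 ≤ h x) (x : V) : T.toGraph.Reachable x (T.root x) := by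
  classical
  by_contra hx
  have hB : 0 ≤ T.cost x := (h0 _).trans (hT.root_le_cost hδ (Finset.mem_univ x))
  have hc : IsPseudometric fun u v => if T.toGraph.Reachable u v then 0 else T.cost x + 1 := by
    refine ⟨fun u => if_pos (SimpleGraph.Reachable.refl u), fun u v => ?_, fun u v w => ?_⟩
    · simp only [SimpleGraph.reachable_comm]
    · split_ifs with h1 h2 h3 h3 h2 h3 h3 <;> try linarith
      exact absurd (h2.trans h3) h1
  have h1 := hT.cost_ge _ hc
    (fun y _ => by simpa only [toGraph_reachable_par, if_true] using hδ.nonneg y (T.par y))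
    x (Finset.mem_univ x)
  simp only [hx, if_false] at h1
  linarith [h0 (T.root x)]

lemma Spans.isTree_toGraph [Nonempty V] (hT : T.Spans Finset.univ δ h m) (hδ : IsPseudometric δ)
    (h0 : ∀ x, 0 ≤ h x) (hr : ∀ u v, T.root u = T.root v) : T.toGraph.IsTree := by
  classical
  have hconn : T.toGraph.Connected :=
    (SimpleGraph.connected_iff _).2 ⟨fun u v => (hT.reachable_root hδ h0 u).trans
      (hr u v ▸ (hT.reachable_root hδ h0 v).symm), inferInstance⟩
  obtain ⟨r⟩ := ‹Nonempty V›
  have hroot : T.par (T.root r) = T.root r := hT.par_root r (Finset.mem_univ r)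
  have hsub : T.toGraph.edgeSet ⊆ (fun x => s(x, T.par x)) '' {T.root r}ᶜ := by
    intro e he
    induction e using Sym2.inductionOn with
    | _ x y =>
      obtain ⟨hne, hxy | hxy⟩ := T.toGraph_adj.1 he
      · refine ⟨x, fun hx => hne ?_, by simp only [hxy]⟩
        rw [← hxy, Set.mem_singleton_iff.1 hx, hroot]
      · refine ⟨y, fun hy => hne ?_, by simp only [hxy, Sym2.eq_swap (a := x)]⟩
        rw [← hxy, Set.mem_singleton_iff.1 hy, hroot]
  have hcard : Nat.card T.toGraph.edgeSet + 1 ≤ Nat.card V := by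
    have h1 := (Set.ncard_le_ncard hsub).trans (Set.ncard_image_le (Set.toFinite _))
    have h2 := Set.ncard_add_ncard_compl {T.root r}
    rw [Set.ncard_singleton] at h2
    rw [Nat.card_coe_set_eq]
    lia
  exact SimpleGraph.isTree_iff_connected_and_card.2
    ⟨hconn, le_antisymm hcard hconn.card_vert_le_card_edgeSet_add_one⟩

lemma Spans.pathwidthLE_toGraph {k : ℕ} (hT : T.Spans Finset.univ δ h (k + 1)) :
    pathwidthLE T.toGraph k := by
  have hhi : ∀ x, T.hi x < Finset.univ.sup T.hi + 1 := fun x =>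
    Nat.lt_succ_of_le (Finset.le_sup (Finset.mem_univ x))
  have hbag : ∀ x y, T.par x = y → ∃ i : Fin (Finset.univ.sup T.hi + 1),
      (T.lo x ≤ i ∧ i ≤ T.hi x) ∧ (T.lo y ≤ i ∧ i ≤ T.hi y) := by
    rintro x _ rfl
    have h1 := hT.lo_le_hi x (Finset.mem_univ x)
    have h2 := hT.lo_le_hi _ (Finset.mem_univ (T.par x))
    have h3 := hT.lo_le_hi_par x (Finset.mem_univ x)
    have h4 := hhi x
    have h5 := hhi (T.par x)
    exact ⟨⟨max (T.lo x) (T.lo (T.par x)), by lia⟩, by simp only; lia⟩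
  refine ⟨Finset.univ.sup T.hi + 1,
    fun i => Finset.univ.filter fun x => T.lo x ≤ i ∧ i ≤ T.hi x, ⟨fun x => ?_,
    fun x y hxy => ?_, fun x i j l hij hjl hi hl => ?_⟩, fun i => hT.card_le i⟩
  · exact ⟨⟨T.hi x, hhi x⟩, by simpa using hT.lo_le_hi x (Finset.mem_univ x)⟩
  · simp only [Finset.mem_filter, Finset.mem_univ, true_and]
    obtain ⟨-, hxy | hxy⟩ := T.toGraph_adj.1 hxy
    · exact hbag x y hxy
    · obtain ⟨i, h1, h2⟩ := hbag y x hxy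
      exact ⟨i, h2, h1⟩
  · simp only [Finset.mem_filter, Finset.mem_univ, true_and] at hi hl ⊢
    exact ⟨hi.1.trans hij, le_trans hjl hl.2⟩

end ToGraph

/-- A spanning forest with a single root gives a tree metric dominating `δ`. -/
lemma Spans.exists_treeMetric {n k : ℕ} [Nonempty (Fin n)] {T : ApexTree (Fin n)}
    {δ : Fin n → Fin n → ℝ} {h : Fin n → ℝ} (hT : T.Spans Finset.univ δ h (k + 1))
    (hδ : IsPseudometric δ) (h0 : ∀ x, 0 ≤ h x) (hr : ∀ u v, T.root u = T.root v) :
    ∃ d : Fin n → Fin n → ℝ, (⟨n, d⟩ : FinMetric) ∈ SupportedMetrics (TreePathwidthFam k) ∧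
      IsPseudometric d ∧ (∀ u v, δ u v ≤ d u v) ∧ ∀ u v, d u v ≤ T.dist u v := by
  have htree := hT.isTree_toGraph hδ h0 hr
  have hconn := htree.connected
  have hl : ∀ e, 0 ≤ edgeLength δ hδ.symm e := fun e => by
    induction e using Sym2.inductionOn with
    | _ x y => exact hδ.nonneg x y
  have hd := isPseudometric_spDist hl hconn
  refine ⟨spDist T.toGraph (edgeLength δ hδ.symm), ⟨T.toGraph, ⟨htree, hT.pathwidthLE_toGraph⟩,
    hconn, _, hl, fun _ _ => rfl⟩, hd, fun u v => ?_, fun u v => ?_⟩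
  · exact le_spDist (hconn.preconnected u v) (hδ.le_walk_length fun _ _ _ => le_rfl)
  · refine hT.dist_ge _ hd (fun x _ => ?_) u (Finset.mem_univ u) v (Finset.mem_univ v) (hr u v)
    by_cases hx : x = T.par x
    · rw [← hx, hd.self, hδ.self]
    · exact spDist_le_of_adj hl (T.toGraph_adj.2 ⟨hx, Or.inl rfl⟩)

end ApexTree

/-- The interval representation given by a path decomposition. -/
lemma pathwidthLE.exists_intervals {V : Type} [Fintype V] {G : SimpleGraph V} {k : ℕ}
    (hG : pathwidthLE G k) : ∃ α β : V → ℕ, (∀ x, α x ≤ β x) ∧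
      (∀ u v, G.Adj u v → α u ≤ β v ∧ α v ≤ β u) ∧
      ∀ t, (Finset.univ.filter fun x => α x ≤ t ∧ t ≤ β x).card ≤ k + 1 := by
  classical
  obtain ⟨N, X, ⟨hX, hadj, hint⟩, hcard⟩ := hG
  have hne : ∀ x, (Finset.univ.filter fun i => x ∈ X i).Nonempty := fun x => by
    obtain ⟨i, hi⟩ := hX x
    exact ⟨i, by simpa using hi⟩
  have ha := fun x => Finset.exists_min_image _ id (hne x)
  have hb := fun x => Finset.exists_max_image _ id (hne x)
  simp only [Finset.mem_filter, Finset.mem_univ, true_and, id] at ha hb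
  choose a ha hamin using ha
  choose b hb hbmax using hb
  refine ⟨fun x => a x, fun x => b x, fun x => hamin x _ (hb x), fun u v huv => ?_, fun t => ?_⟩
  · obtain ⟨i, hu, hv⟩ := hadj huv
    exact ⟨(hamin u i hu).trans (hbmax v i hv), (hamin v i hv).trans (hbmax u i hu)⟩
  · rcases Finset.eq_empty_or_nonempty
      (Finset.univ.filter fun x => (a x : ℕ) ≤ t ∧ t ≤ (b x : ℕ)) with he | ⟨x, hx⟩
    · rw [he, Finset.card_empty]
      exact Nat.zero_le _
    · have ht : t < N := (Finset.mem_filter.1 hx).2.2.trans_lt (b x).2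
      refine (Finset.card_le_card fun y hy => ?_).trans (hcard ⟨t, ht⟩)
      obtain ⟨-, h1, h2⟩ := Finset.mem_filter.1 hy
      exact hint y (a y) ⟨t, ht⟩ (b y) h1 h2 (ha y) (hb y)

/-- A random forest whose apex is far away can be conditioned on being a tree. -/
lemma HasRandomApexTree.stochEmbeds {n k : ℕ} {G : SimpleGraph (Fin n)}
    (hG : G.Connected) {len : Sym2 (Fin n) → ℝ} (hl : ∀ e, 0 ≤ len e) {α β : Fin n → ℕ}
    (hαβ : ∀ u v, G.Adj u v → α u ≤ β v ∧ α v ≤ β u) {D H : ℝ} (hD : 0 ≤ D) (hH : 0 < H)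
    (hDH : D * ∑ u, ∑ v, spDist G len u v ≤ H)
    (hT : HasRandomApexTree Finset.univ (spDist G len) (fun _ => H) α β (k + 1) D) :
    StochEmbeds (spDist G len) (SupportedMetrics (TreePathwidthFam k)) (2 * D) := by
  classical
  obtain ⟨Ω, _, p, T, hp, hp1, hT, hlen, -⟩ := hT
  have hδ := isPseudometric_spDist hl hG
  have : Nonempty (Fin n) := hG.nonempty
  have hH0 : ∀ x : Fin n, 0 ≤ (fun _ => H) x := fun _ => hH.le
  have hapart : ∀ ω u v, (T ω).root u ≠ (T ω).root v → 2 * H ≤ (T ω).length u v := by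
    intro ω u v huv
    rw [ApexTree.length, if_neg huv]
    linarith [(hT ω).root_le_cost hδ (Finset.mem_univ u),
      (hT ω).root_le_cost hδ (Finset.mem_univ v)]
  have hlen0 : ∀ ω u v, 0 ≤ (T ω).length u v := by
    intro ω u v
    by_cases huv : (T ω).root u = (T ω).root v
    · rw [ApexTree.length, if_pos huv]
      exact (hT ω).dist_nonneg hδ (Finset.mem_univ u) (Finset.mem_univ v) huv
    · linarith [hapart ω u v huv]
  set Good : Ω → Prop := fun ω => ∀ u v, (T ω).root u = (T ω).root v with hGood
  set P := ∑ ω : {ω // Good ω}, p ω with hP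
  have hbad : ∀ ω, ¬ Good ω →
      2 * H ≤ ∑ u, ∑ v, if G.Adj u v then (T ω).length u v else 0 := by
    intro ω hω
    obtain ⟨u, v, huv, hne⟩ : ∃ u v, G.Adj u v ∧ (T ω).root u ≠ (T ω).root v := by
      by_contra hcon
      push Not at hcon
      refine hω fun u v => ?_
      obtain ⟨w⟩ := hG.preconnected u v
      induction w with
      | nil => rfl
      | cons h _ ih => exact (hcon _ _ h).trans ih
    have hnn : ∀ u v, 0 ≤ if G.Adj u v then (T ω).length u v else 0 := fun u v => by
      split_ifs
      · exact hlen0 ω u v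
      · exact le_rfl
    calc 2 * H ≤ if G.Adj u v then (T ω).length u v else 0 := by
          rw [if_pos huv]
          exact hapart ω u v hne
      _ ≤ ∑ v, if G.Adj u v then (T ω).length u v else 0 :=
          Finset.single_le_sum (fun v _ => hnn u v) (Finset.mem_univ v)
      _ ≤ _ := Finset.single_le_sum (f := fun u => ∑ v, if G.Adj u v then (T ω).length u v else 0)
          (fun u _ => Finset.sum_nonneg fun v _ => hnn u v) (Finset.mem_univ u)
  have hexp : ∑ ω, p ω * ∑ u, ∑ v, (if G.Adj u v then (T ω).length u v else 0) ≤ H := by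
    refine le_trans ?_ hDH
    simp only [Finset.mul_sum]
    rw [Finset.sum_comm]
    refine Finset.sum_le_sum fun u _ => ?_
    rw [Finset.sum_comm]
    refine Finset.sum_le_sum fun v _ => ?_
    by_cases huv : G.Adj u v
    · simp only [huv, if_true]
      exact hlen u (Finset.mem_univ u) v (Finset.mem_univ v) (hαβ u v huv).1 (hαβ u v huv).2
    · simp only [huv, if_false, mul_zero, Finset.sum_const_zero]
      exact mul_nonneg hD (hδ.nonneg u v)
  have hPhalf : 1 / 2 ≤ P := by
    have h1 : ∑ ω, p ω = P + ∑ ω : {ω // ¬ Good ω}, p ω :=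
      (Fintype.sum_subtype_add_sum_subtype Good p).symm
    have h2 : (∑ ω : {ω // ¬ Good ω}, p ω) * (2 * H) ≤ H := by
      refine le_trans ?_ hexp
      rw [← Fintype.sum_subtype_add_sum_subtype Good, Finset.sum_mul]
      refine le_add_of_nonneg_of_le (Finset.sum_nonneg fun ω _ => mul_nonneg (hp ω) ?_)
        (Finset.sum_le_sum fun ω _ => mul_le_mul_of_nonneg_left (hbad ω ω.2) (hp ω))
      refine Finset.sum_nonneg fun u _ => Finset.sum_nonneg fun v _ => ?_
      split_ifs
      · exact hlen0 ω u v
      · exact le_rfl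
    nlinarith
  have hP0 : 0 < P := by linarith
  choose d hd hdm hδd hdd using fun ω : {ω // Good ω} =>
    (hT ω.1).exists_treeMetric hδ hH0 ω.2
  have hp' : ∀ ω, 0 ≤ p ω / P := fun ω => div_nonneg (hp ω) hP0.le
  have hmean : IsPseudometric fun u v => ∑ ω : {ω // Good ω}, p ω / P * d ω u v := by
    refine ⟨fun u => by simp [(hdm _).self], fun u v => by simp only [(hdm _).symm u v],
      fun u v w => ?_⟩
    rw [← Finset.sum_add_distrib]
    refine Finset.sum_le_sum fun ω _ => ?_
    rw [← mul_add]
    exact mul_le_mul_of_nonneg_left ((hdm ω).triangle u v w) (hp' ω)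
  have hadj : ∀ u v, G.Adj u v →
      ∑ ω : {ω // Good ω}, p ω / P * d ω u v ≤ 2 * D * len s(u, v) := by
    intro u v huv
    have h1 := hlen u (Finset.mem_univ u) v (Finset.mem_univ v) (hαβ u v huv).1 (hαβ u v huv).2
    calc ∑ ω : {ω // Good ω}, p ω / P * d ω u v
        = (∑ ω : {ω // Good ω}, p ω * d ω u v) / P := by
          rw [Finset.sum_div]
          exact Finset.sum_congr rfl fun ω _ => by ring
      _ ≤ (∑ ω, p ω * (T ω).length u v) / P := by
          refine div_le_div_of_nonneg_right ?_ hP0.le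
          rw [← Fintype.sum_subtype_add_sum_subtype Good]
          refine le_add_of_le_of_nonneg (Finset.sum_le_sum fun ω _ => ?_)
            (Finset.sum_nonneg fun ω _ => mul_nonneg (hp ω) (hlen0 ω u v))
          rw [ApexTree.length, if_pos (ω.2 u v)]
          exact mul_le_mul_of_nonneg_left (hdd ω u v) (hp ω)
      _ ≤ 2 * (D * spDist G len u v) := by
          rw [div_le_iff₀ hP0]
          have h2 := mul_nonneg hD (hδ.nonneg u v)
          nlinarith
      _ ≤ 2 * D * len s(u, v) := by
          rw [mul_assoc]
          gcongr
          exact spDist_le_of_adj hl huv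
  refine ⟨Fintype.card {ω // Good ω}, fun i => p ((Fintype.equivFin {ω // Good ω}).symm i) / P,
    fun i => ⟨n, d ((Fintype.equivFin {ω // Good ω}).symm i)⟩, fun _ x => x, fun i => hp' _, ?_,
    fun i _ => hd _, fun i _ x y => hδd _ x y, fun x y => ?_⟩
  · rw [Equiv.sum_comp (Fintype.equivFin {ω // Good ω}).symm fun ω => p ω / P, ← Finset.sum_div,
      div_self hP0.ne']
  · rw [Equiv.sum_comp (Fintype.equivFin {ω // Good ω}).symm fun ω => p ω / P * d ω x y]
    obtain ⟨w, -, hw⟩ := exists_path_length_eq_spDist hl (hG.preconnected x y)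
    rw [← hw, ← List.sum_map_mul_left]
    exact hmean.le_walk_length (len := fun e => 2 * D * len e) hadj w

/-- **Theorem.** For every `k ≥ 1` there is a constant `D = D(k)` such that every shortest-path
metric supported on a graph of pathwidth at most `k` admits a stochastic `D`-embedding into the
shortest-path metrics supported on trees of pathwidth at most `k`:
`Pathwidth(k) ⇝ Trees ∩ Pathwidth(k)`. -/
theorem pathwidth_into_trees_of_pathwidth (k : ℕ) (hk : 1 ≤ k) :
    ∃ D : ℝ, 1 ≤ D ∧ ∀ Y ∈ SupportedMetrics (PathwidthFam k),
      StochEmbeds Y.2 (SupportedMetrics (TreePathwidthFam k)) D := by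
  obtain ⟨D, hD, hmain⟩ := exists_hasRandomApexTree (Nat.le_add_left 1 k)
  refine ⟨2 * D + 1, by linarith, ?_⟩
  rintro ⟨n, d⟩ hY
  obtain ⟨G, hG, hconn, len, hl, hd⟩ : ∃ G : SimpleGraph (Fin n), pathwidthLE G k ∧ G.Connected ∧
    ∃ len : Sym2 (Fin n) → ℝ, (∀ e, 0 ≤ len e) ∧ ∀ u v, d u v = spDist G len u v := hY
  obtain rfl : d = spDist G len := funext fun u => funext fun v => hd u v
  obtain ⟨α, β, hαβ, hadj, hcard⟩ := pathwidthLE.exists_intervals hG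
  have hδ := isPseudometric_spDist hl hconn
  have hC : 0 ≤ D * ∑ u, ∑ v, spDist G len u v :=
    mul_nonneg hD (Finset.sum_nonneg fun u _ => Finset.sum_nonneg fun v _ => hδ.nonneg u v)
  set H := D * (∑ u, ∑ v, spDist G len u v) + 1 with hH
  have hH0 : 0 < H := by linarith
  obtain ⟨N, p, Y, F, h1, h2, h3, h4, h5⟩ :=
    (hmain _ Finset.univ (spDist G len) (fun _ => H) α β hδ (fun _ => hH0.le)
      (fun x y => by simpa using hδ.nonneg x y) (fun x _ => hαβ x) hcard).stochEmbeds hconn hl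
      hadj hD hH0 (by linarith)
  exact ⟨N, p, Y, F, h1, h2, h3, h4, fun x y => (h5 x y).trans
    (mul_le_mul_of_nonneg_right (by linarith) (hδ.nonneg x y))⟩
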